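/- arXiv:0912.1124 — 2 statements merged into one kernel-verified Lean document; each statement's English description precedes it below -/
import Mathlib

section
/- Let p: B → G be a Fell bundle over a locally compact Hausdorff groupoid G, and let A := Γ₀(G⁰; B) be the C*-algebra of B sitting over the unit space G⁰. Then the underlying Banach bundle of B is continuous if and only if A is a continuous C₀(G⁰)-algebra, i.e., if and only if u ↦ ‖q_u(a)‖ is continuous on G⁰ for every a ∈ A. -/
noncomputable section

open Filter
open scoped Topology

/-- A locally compact Hausdorff groupoid, encoded "flatly": the partially defined
multiplication `gmul` is a total function whose value is only meaningful (and only
constrained by the axioms) on composable pairs, i.e. pairs `(x, y)` with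
`src x = rng y`. -/
structure LCGroupoid where
  /-- the underlying space of the groupoid -/
  G : Type
  [topG : TopologicalSpace G]
  t2G : T2Space G
  lcG : LocallyCompactSpace G
  /-- the source map (with values in the unit space) -/
  src : G → G
  /-- the range map (with values in the unit space) -/
  rng : G → G
  /-- the partial multiplication (junk value unless `src x = rng y`) -/
  gmul : G → G → G
  /-- inversion -/
  ginv : G → G
  src_rng : ∀ x, src (rng x) = rng x
  rng_rng : ∀ x, rng (rng x) = rng x
  src_src : ∀ x, src (src x) = src x
  rng_src : ∀ x, rng (src x) = src x
  rng_gmul : ∀ x y, src x = rng y → rng (gmul x y) = rng x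
  src_gmul : ∀ x y, src x = rng y → src (gmul x y) = src y
  gmul_assoc : ∀ x y z, src x = rng y → src y = rng z →
    gmul (gmul x y) z = gmul x (gmul y z)
  gmul_rng : ∀ x, gmul (rng x) x = x
  gmul_src : ∀ x, gmul x (src x) = x
  src_ginv : ∀ x, src (ginv x) = rng x
  rng_ginv : ∀ x, rng (ginv x) = src x
  ginv_ginv : ∀ x, ginv (ginv x) = x
  gmul_ginv : ∀ x, gmul x (ginv x) = rng x
  ginv_gmul : ∀ x, gmul (ginv x) x = src x
  ginv_gmul_eq : ∀ x y, src x = rng y → ginv (gmul x y) = gmul (ginv y) (ginv x)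
  ginv_unit : ∀ u, rng u = u → ginv u = u
  cont_ginv : Continuous ginv
  cont_gmul : Continuous (fun q : {q : G × G // src q.1 = rng q.2} => gmul q.1.1 q.1.2)

attribute [instance] LCGroupoid.topG

/-- The unit space `G⁰` of the groupoid, i.e. the set of units, with its subspace
topology. -/
def LCGroupoid.UnitSpace (Γ : LCGroupoid) : Type := {u : Γ.G // Γ.rng u = u}

instance (Γ : LCGroupoid) : TopologicalSpace Γ.UnitSpace :=
  instTopologicalSpaceSubtype

/-- The data and most axioms of a Fell bundle `p : B → G` over a locally compact
Hausdorff groupoid, again encoded "flatly": the total space is `T`, the fibre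
`B(x)` is `{b : T | p b = x}`, the fibrewise algebraic operations are total
functions which are constrained by the axioms only on the appropriate domains
(e.g. `badd` on pairs in a common fibre, `bmul` on pairs whose base points are
composable).  The axioms say: each fibre is a complex Banach space (whose
topology is the subspace topology); the norm is upper semicontinuous and the
bundle operations are continuous; `bmul`/`bstar` are a continuous bilinear
associative multiplication and involution covering the groupoid operations;
each unit fibre `B(u)` is a C*-algebra (C*-identity, submultiplicativity,
positivity of `b* b`). Saturation is added in `FellBundle` below. -/
structure FellBundleData extends LCGroupoid where
  /-- the total space of the bundle -/
  T : Type
  [topT : TopologicalSpace T]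
  /-- the bundle projection -/
  p : T → G
  /-- the fibrewise norm -/
  bnorm : T → ℝ
  /-- fibrewise addition (junk unless both arguments lie in a common fibre) -/
  badd : T → T → T
  /-- fibrewise scalar multiplication -/
  bsmul : ℂ → T → T
  /-- the zero section -/
  bzero : G → T
  /-- the Fell bundle multiplication (junk unless `src (p a) = rng (p b)`) -/
  bmul : T → T → T
  /-- the Fell bundle involution -/
  bstar : T → T
  p_cont : Continuous p
  p_open : IsOpenMap p
  p_badd : ∀ a b, p a = p b → p (badd a b) = p a
  p_bsmul : ∀ c a, p (bsmul c a) = p a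
  p_bzero : ∀ x, p (bzero x) = x
  p_bmul : ∀ a b, src (p a) = rng (p b) → p (bmul a b) = gmul (p a) (p b)
  p_bstar : ∀ a, p (bstar a) = ginv (p a)
  badd_comm : ∀ a b, p a = p b → badd a b = badd b a
  badd_assoc : ∀ a b c, p a = p b → p b = p c → badd (badd a b) c = badd a (badd b c)
  bzero_badd : ∀ a, badd (bzero (p a)) a = a
  badd_neg : ∀ a, badd a (bsmul (-1) a) = bzero (p a)
  one_bsmul : ∀ a, bsmul 1 a = a
  mul_bsmul : ∀ c d a, bsmul (c * d) a = bsmul c (bsmul d a)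
  add_bsmul : ∀ c d a, bsmul (c + d) a = badd (bsmul c a) (bsmul d a)
  bsmul_badd : ∀ c a b, p a = p b → bsmul c (badd a b) = badd (bsmul c a) (bsmul c b)
  zero_bsmul : ∀ a, bsmul 0 a = bzero (p a)
  bsmul_bzero : ∀ c x, bsmul c (bzero x) = bzero x
  bnorm_nonneg : ∀ a, 0 ≤ bnorm a
  bnorm_badd_le : ∀ a b, p a = p b → bnorm (badd a b) ≤ bnorm a + bnorm b
  bnorm_bsmul : ∀ c a, bnorm (bsmul c a) = ‖c‖ * bnorm a
  bnorm_eq_zero : ∀ a, bnorm a = 0 ↔ a = bzero (p a)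
  /-- each fibre is complete -/
  fiber_complete : ∀ x (f : ℕ → T), (∀ n, p (f n) = x) →
    (∀ ε : ℝ, 0 < ε → ∃ N, ∀ m n, N ≤ m → N ≤ n →
      bnorm (badd (f m) (bsmul (-1) (f n))) < ε) →
    ∃ L, p L = x ∧
      Tendsto (fun n => bnorm (badd (f n) (bsmul (-1) L))) atTop (nhds 0)
  cont_badd : Continuous (fun q : {q : T × T // p q.1 = p q.2} => badd q.1.1 q.1.2)
  cont_bsmul : Continuous (fun q : ℂ × T => bsmul q.1 q.2)
  cont_bzero : Continuous bzero
  usc_bnorm : UpperSemicontinuous bnorm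
  /-- on each fibre, the subspace topology is finer than the norm topology -/
  fiber_nbhd_norm : ∀ b, ∀ ε : ℝ, 0 < ε →
    ∃ U ∈ nhds b, ∀ c ∈ U, p c = p b → bnorm (badd c (bsmul (-1) b)) < ε
  /-- on each fibre, the norm topology is finer than the subspace topology -/
  norm_nbhd_fiber : ∀ b, ∀ U ∈ nhds b, ∃ ε : ℝ, 0 < ε ∧
    ∀ c, p c = p b → bnorm (badd c (bsmul (-1) b)) < ε → c ∈ U
  /-- if `‖b_i‖ → 0` and `p (b_i) → x` then `b_i → 0_x` -/
  zero_nbhd : ∀ x, ∀ U ∈ nhds (bzero x), ∃ V ∈ nhds x, ∃ ε : ℝ, 0 < ε ∧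
    ∀ b, p b ∈ V → bnorm b < ε → b ∈ U
  bmul_assoc : ∀ a b c, src (p a) = rng (p b) → src (p b) = rng (p c) →
    bmul (bmul a b) c = bmul a (bmul b c)
  bmul_badd : ∀ a a' b, p a = p a' → src (p a) = rng (p b) →
    bmul (badd a a') b = badd (bmul a b) (bmul a' b)
  badd_bmul : ∀ a b b', p b = p b' → src (p a) = rng (p b) →
    bmul a (badd b b') = badd (bmul a b) (bmul a b')
  bsmul_bmul : ∀ (c : ℂ) a b, src (p a) = rng (p b) →
    bmul (bsmul c a) b = bsmul c (bmul a b)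
  bmul_bsmul : ∀ (c : ℂ) a b, src (p a) = rng (p b) →
    bmul a (bsmul c b) = bsmul c (bmul a b)
  cont_bmul :
    Continuous (fun q : {q : T × T // src (p q.1) = rng (p q.2)} => bmul q.1.1 q.1.2)
  bstar_bstar : ∀ a, bstar (bstar a) = a
  bstar_badd : ∀ a b, p a = p b → bstar (badd a b) = badd (bstar a) (bstar b)
  bstar_bsmul : ∀ c a, bstar (bsmul c a) = bsmul (starRingEnd ℂ c) (bstar a)
  bstar_bmul : ∀ a b, src (p a) = rng (p b) →
    bstar (bmul a b) = bmul (bstar b) (bstar a)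
  cont_bstar : Continuous bstar
  /-- the C*-identity `‖b* b‖ = ‖b‖ ^ 2` (this holds in every fibre since `B(x)` is
  an imprimitivity bimodule with inner products `⟨a, b⟩ = a* b` and `a b*`) -/
  cstar_identity : ∀ a, bnorm (bmul (bstar a) a) = bnorm a ^ 2
  /-- the norm on each unit fibre (a C*-algebra) is submultiplicative -/
  unit_submul : ∀ a b, p a = p b → rng (p a) = p a →
    bnorm (bmul a b) ≤ bnorm a * bnorm b
  /-- `b* b ≥ 0` in the C*-algebra `B(s(b))`: positivity in a C*-algebra is
  encoded as being of the form `c* c` -/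
  bmul_pos : ∀ a, ∃ c, p c = src (p a) ∧ bmul (bstar a) a = bmul (bstar c) c

attribute [instance] FellBundleData.topT

namespace FellBundleData

variable (Ω : FellBundleData)

/-- The fibre `B(x)` of the bundle over `x`, as a subset of the total space. -/
def fiberSet (x : Ω.G) : Set Ω.T := {b | Ω.p b = x}

/-- Finite sums of elements of `S`, computed in the fibre over `x`. -/
def finSums (x : Ω.G) (S : Set Ω.T) : Set Ω.T :=
  {t | ∃ l : List Ω.T, (∀ a ∈ l, a ∈ S) ∧ t = l.foldr Ω.badd (Ω.bzero x)}

/-- The linear span of `S` inside the fibre over `x`. -/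
def spanIn (x : Ω.G) (S : Set Ω.T) : Set Ω.T :=
  Ω.finSums x {t | ∃ c s, s ∈ S ∧ t = Ω.bsmul c s}

/-- The closed linear span of `S` inside the fibre over `x`. -/
def closedSpan (x : Ω.G) (S : Set Ω.T) : Set Ω.T := closure (Ω.spanIn x S)

end FellBundleData

/-- A (saturated) Fell bundle over a locally compact Hausdorff groupoid. -/
structure FellBundle extends FellBundleData where
  /-- saturation: `B(x) B(y)` spans a dense subspace of `B(xy)` -/
  saturated : ∀ x y, src x = rng y →
    toFellBundleData.closedSpan (gmul x y)
        {t | ∃ a b, p a = x ∧ p b = y ∧ t = bmul a b} =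
      toFellBundleData.fiberSet (gmul x y)

namespace FellBundleData

variable (Ω : FellBundleData)

/-- `Ω.IsA σ` says that `σ` is an element of the C*-algebra `A = Γ₀(G⁰; B)` of the
Fell bundle sitting over the unit space: a continuous section over `G⁰` vanishing
at infinity. -/
def IsA (σ : Ω.toLCGroupoid.UnitSpace → Ω.T) : Prop :=
  (∀ u, Ω.p (σ u) = u.1) ∧ Continuous σ ∧
    ∀ ε : ℝ, 0 < ε →
      ∃ K : Set Ω.toLCGroupoid.UnitSpace, IsCompact K ∧ ∀ u ∉ K, Ω.bnorm (σ u) < ε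

/-- `Ω.IsIdealA J` says that `J` is a (closed, two-sided) ideal in the C*-algebra
`A = Γ₀(G⁰; B)`. -/
def IsIdealA (J : Set (Ω.toLCGroupoid.UnitSpace → Ω.T)) : Prop :=
  (∀ σ ∈ J, Ω.IsA σ) ∧
  ((fun u => Ω.bzero u.1) ∈ J) ∧
  (∀ σ ∈ J, ∀ τ ∈ J, (fun u => Ω.badd (σ u) (τ u)) ∈ J) ∧
  (∀ c : ℂ, ∀ σ ∈ J, (fun u => Ω.bsmul c (σ u)) ∈ J) ∧
  (∀ σ ∈ J, ∀ τ, Ω.IsA τ →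
    (fun u => Ω.bmul (σ u) (τ u)) ∈ J ∧ (fun u => Ω.bmul (τ u) (σ u)) ∈ J) ∧
  (∀ σ, Ω.IsA σ →
    (∀ ε : ℝ, 0 < ε → ∃ τ ∈ J, ∀ u, Ω.bnorm (Ω.badd (σ u) (Ω.bsmul (-1) (τ u))) < ε) →
    σ ∈ J)

/-- The image `q_u(J) = J(u) ⊆ B(u) = A(u)` of a subset `J ⊆ A` in the fibre over
the unit `u`. -/
def fiberIm (J : Set (Ω.toLCGroupoid.UnitSpace → Ω.T)) (u : Ω.G) : Set Ω.T :=
  {t | ∃ σ ∈ J, ∃ h : Ω.rng u = u, t = σ ⟨u, h⟩}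

/-- A representation of the C*-algebra `B(u)` (`u` a unit) on a Hilbert space `H`:
a `*`-homomorphism `π` on the fibre over `u`, automatically norm-decreasing. -/
def IsFiberRep (u : Ω.G) {H : Type} [NormedAddCommGroup H] [InnerProductSpace ℂ H]
    [CompleteSpace H] (π : Ω.T → H →L[ℂ] H) : Prop :=
  (∀ a b, Ω.p a = u → Ω.p b = u → π (Ω.badd a b) = π a + π b) ∧
  (∀ (c : ℂ) a, Ω.p a = u → π (Ω.bsmul c a) = c • π a) ∧
  (∀ a b, Ω.p a = u → Ω.p b = u → π (Ω.bmul a b) = (π a).comp (π b)) ∧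
  (∀ a, Ω.p a = u → π (Ω.bstar a) = ContinuousLinearMap.adjoint (π a)) ∧
  (∀ a, Ω.p a = u → ‖π a‖ ≤ Ω.bnorm a)

/-- An irreducible representation of the C*-algebra `B(u)`: nonzero, and with no
nontrivial closed invariant subspace. -/
def IsIrredFiberRep (u : Ω.G) {H : Type} [NormedAddCommGroup H]
    [InnerProductSpace ℂ H] [CompleteSpace H] (π : Ω.T → H →L[ℂ] H) : Prop :=
  Ω.IsFiberRep u π ∧ (∃ a, Ω.p a = u ∧ π a ≠ 0) ∧
  (∀ K : Submodule ℂ H, IsClosed (K : Set H) →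
    (∀ a, Ω.p a = u → ∀ v ∈ K, π a v ∈ K) → K = ⊥ ∨ K = ⊤)

/-- The primitive ideal space `Prim A(u)` of the C*-algebra `A(u) = B(u)` over a
unit `u`: the set of kernels of irreducible representations of `B(u)`, viewed as
subsets of the fibre over `u`. -/
def PrimFiber (u : Ω.G) : Set (Set Ω.T) :=
  {P | Ω.rng u = u ∧
    ∃ (H : Type) (iN : NormedAddCommGroup H) (iP : InnerProductSpace ℂ H)
      (iC : CompleteSpace H) (π : Ω.T → H →L[ℂ] H),
      Ω.IsIrredFiberRep u π ∧ P = {a | Ω.p a = u ∧ π a = 0}}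

/-- The Rieffel correspondence `h_x` on ideals, induced by the
`A(r(x)) – A(s(x))`-imprimitivity bimodule `B(x)`: an ideal `J ⊆ A(s(x))` is sent
to the induced ideal `⟨B(x)·J, B(x)⟩_{A(r(x))} = span{(a d) b* : a, b ∈ B(x), d ∈ J}`
(closed span) in `A(r(x))`. -/
def hIdeal (x : Ω.G) (J : Set Ω.T) : Set Ω.T :=
  Ω.closedSpan (Ω.rng x)
    {t | ∃ a b d, Ω.p a = x ∧ Ω.p b = x ∧ d ∈ J ∧ t = Ω.bmul (Ω.bmul a d) (Ω.bstar b)}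

/-- `I ⊆ A` is a `G`-invariant ideal: it is an ideal, and its hull
`{(u, P) : I(u) ⊆ P} ⊆ Prim A` is invariant under the `G`-action
`x · (s(x), P) = (r(x), h_x(P))`. -/
def GInvariant (I : Set (Ω.toLCGroupoid.UnitSpace → Ω.T)) : Prop :=
  Ω.IsIdealA I ∧
  ∀ x (P : Set Ω.T), P ∈ Ω.PrimFiber (Ω.src x) →
    Ω.fiberIm I (Ω.src x) ⊆ P → Ω.fiberIm I (Ω.rng x) ⊆ Ω.hIdeal x P

/-- The subset `B_I = {b ∈ B : b* b ∈ I(s(b))}` of the total space associated to an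
ideal `I ⊆ A`. -/
def BIset (I : Set (Ω.toLCGroupoid.UnitSpace → Ω.T)) : Set Ω.T :=
  {b | Ω.bmul (Ω.bstar b) b ∈ Ω.fiberIm I (Ω.src (Ω.p b))}

end FellBundleData

namespace FellBundleData

variable {Ω : FellBundleData}

/-- The fibre of the bundle over `x`, as a type carrying its Banach space structure. -/
@[ext]
structure Fiber (Ω : FellBundleData) (x : Ω.G) where
  /-- the underlying point of the total space -/
  val : Ω.T
  p_val : Ω.p val = x

namespace Fiber

variable {x : Ω.G}

instance : Zero (Ω.Fiber x) := ⟨⟨Ω.bzero x, Ω.p_bzero x⟩⟩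

instance : Add (Ω.Fiber x) :=
  ⟨fun a b => ⟨Ω.badd a.1 b.1, (Ω.p_badd _ _ (a.2.trans b.2.symm)).trans a.2⟩⟩

instance : SMul ℂ (Ω.Fiber x) := ⟨fun c a => ⟨Ω.bsmul c a.1, (Ω.p_bsmul _ _).trans a.2⟩⟩

instance : Neg (Ω.Fiber x) := ⟨fun a => (-1 : ℂ) • a⟩

instance : Norm (Ω.Fiber x) := ⟨fun a => Ω.bnorm a.1⟩

lemma val_zero : (0 : Ω.Fiber x).1 = Ω.bzero x := rfl

lemma norm_def (a : Ω.Fiber x) : ‖a‖ = Ω.bnorm a.1 := rfl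

private lemma add_comm_aux (a b : Ω.Fiber x) : a + b = b + a :=
  Fiber.ext (Ω.badd_comm _ _ (a.2.trans b.2.symm))

private lemma zero_add_aux (a : Ω.Fiber x) : 0 + a = a := by
  obtain ⟨a, rfl⟩ := a
  exact Fiber.ext (Ω.bzero_badd a)

private lemma add_neg_aux (a : Ω.Fiber x) : a + -a = 0 := by
  obtain ⟨a, rfl⟩ := a
  exact Fiber.ext (Ω.badd_neg a)

instance : AddCommGroup (Ω.Fiber x) where
  add_assoc a b c :=
    Fiber.ext (Ω.badd_assoc _ _ _ (a.2.trans b.2.symm) (b.2.trans c.2.symm))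
  zero_add := zero_add_aux
  add_zero a := (add_comm_aux a 0).trans (zero_add_aux a)
  nsmul := nsmulRec
  zsmul := zsmulRec
  neg_add_cancel a := (add_comm_aux (-a) a).trans (add_neg_aux a)
  add_comm := add_comm_aux

instance : Module ℂ (Ω.Fiber x) where
  one_smul _ := Fiber.ext (Ω.one_bsmul _)
  mul_smul c d _ := Fiber.ext (Ω.mul_bsmul c d _)
  smul_zero c := Fiber.ext (Ω.bsmul_bzero c x)
  smul_add c a b := Fiber.ext (Ω.bsmul_badd c _ _ (a.2.trans b.2.symm))
  add_smul c d _ := Fiber.ext (Ω.add_bsmul c d _)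
  zero_smul a := Fiber.ext ((Ω.zero_bsmul _).trans (congrArg Ω.bzero a.2))

lemma normedSpaceCore : NormedSpace.Core ℂ (Ω.Fiber x) where
  norm_nonneg _ := Ω.bnorm_nonneg _
  norm_smul c _ := Ω.bnorm_bsmul c _
  norm_triangle a b := Ω.bnorm_badd_le _ _ (a.2.trans b.2.symm)
  norm_eq_zero_iff a := by
    obtain ⟨a, rfl⟩ := a
    exact ⟨fun h => Fiber.ext ((Ω.bnorm_eq_zero a).1 h),
      fun h => (Ω.bnorm_eq_zero a).2 (congrArg Fiber.val h)⟩

instance : NormedAddCommGroup (Ω.Fiber x) := NormedAddCommGroup.ofCore normedSpaceCore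

instance : NormedSpace ℂ (Ω.Fiber x) := NormedSpace.ofCore normedSpaceCore

lemma norm_sub_eq (a b : Ω.Fiber x) : ‖a - b‖ = Ω.bnorm (Ω.badd a.1 (Ω.bsmul (-1) b.1)) := by
  rw [sub_eq_add_neg]
  rfl

instance : CompleteSpace (Ω.Fiber x) := by
  refine Metric.complete_of_cauchySeq_tendsto fun f hf => ?_
  obtain ⟨L, hL, hlim⟩ := Ω.fiber_complete x (fun n => (f n).1) (fun n => (f n).2) fun ε hε => by
    obtain ⟨N, hN⟩ := Metric.cauchySeq_iff.1 hf ε hε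
    refine ⟨N, fun m n hm hn => ?_⟩
    rw [← norm_sub_eq, ← dist_eq_norm]
    exact hN m hm n hn
  refine ⟨⟨L, hL⟩, tendsto_iff_norm_sub_tendsto_zero.2 ?_⟩
  exact hlim.congr fun n => (norm_sub_eq _ (⟨L, hL⟩ : Ω.Fiber x)).symm

end Fiber

lemma continuousOn_badd (Ω : FellBundleData) :
    ContinuousOn (fun q : Ω.T × Ω.T => Ω.badd q.1 q.2) {q | Ω.p q.1 = Ω.p q.2} :=
  continuousOn_iff_continuous_domRestrict.2 Ω.cont_badd

lemma tendsto_badd {Y : Type*} {l : Filter Y} {f g : Y → Ω.T} {a b : Ω.T}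
    (hf : Tendsto f l (𝓝 a)) (hg : Tendsto g l (𝓝 b))
    (hfg : ∀ᶠ y in l, Ω.p (f y) = Ω.p (g y)) (hab : Ω.p a = Ω.p b) :
    Tendsto (fun y => Ω.badd (f y) (g y)) l (𝓝 (Ω.badd a b)) :=
  (Ω.continuousOn_badd (a, b) hab).tendsto.comp
    (tendsto_nhdsWithin_iff.2 ⟨hf.prodMk_nhds hg, hfg⟩)

lemma tendsto_bsmul {Y : Type*} {l : Filter Y} {c : Y → ℂ} {f : Y → Ω.T} {d : ℂ} {a : Ω.T}
    (hc : Tendsto c l (𝓝 d)) (hf : Tendsto f l (𝓝 a)) :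
    Tendsto (fun y => Ω.bsmul (c y) (f y)) l (𝓝 (Ω.bsmul d a)) :=
  (Ω.cont_bsmul.tendsto (d, a)).comp (hc.prodMk_nhds hf)

/-- The elements of `W` are at distance less than `δ` from those of `O` in the same fibre. -/
def Near (W O : Set Ω.T) (δ : ℝ) : Prop :=
  ∀ ⦃x : Ω.G⦄ (a b : Ω.Fiber x), a.1 ∈ W → b.1 ∈ O → ‖a - b‖ < δ

lemma Near.mono {W W' O O' : Set Ω.T} {δ : ℝ} (h : Near W O δ) (hW : W' ⊆ W) (hO : O' ⊆ O) :
    Near W' O' δ :=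
  fun _ a b ha hb => h a b (hW ha) (hO hb)

lemma eventually_norm_sub_lt {Y : Type*} {l : Filter Y} {f g : Y → Ω.T} {x : Ω.G}
    {a b : Ω.Fiber x} {δ : ℝ} (hf : Tendsto f l (𝓝 a.1)) (hg : Tendsto g l (𝓝 b.1))
    (hfg : ∀ᶠ y in l, Ω.p (f y) = Ω.p (g y)) (h : ‖a - b‖ < δ) :
    ∀ᶠ y in l, Ω.bnorm (Ω.badd (f y) (Ω.bsmul (-1) (g y))) < δ := by
  refine (tendsto_badd hf (tendsto_bsmul (tendsto_const_nhds (x := (-1 : ℂ))) hg) ?_ ?_).eventually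
    (Ω.usc_bnorm _ δ ?_)
  · simpa only [Ω.p_bsmul] using hfg
  · rw [Ω.p_bsmul, a.2, b.2]
  · exact (Fiber.norm_sub_eq a b).symm.trans_lt h

lemma exists_isOpen_near_self (b : Ω.T) {δ : ℝ} (hδ : 0 < δ) :
    ∃ U, IsOpen U ∧ b ∈ U ∧ Near U U δ := by
  let Z : Set (Ω.T × Ω.T) := {q | Ω.p q.1 = Ω.p q.2}
  have h : ∀ᶠ q in 𝓝[Z] (b, b), Ω.bnorm (Ω.badd q.1 (Ω.bsmul (-1) q.2)) < δ := by
    refine eventually_norm_sub_lt (a := (⟨b, rfl⟩ : Ω.Fiber (Ω.p b))) (b := ⟨b, rfl⟩)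
      (tendsto_nhdsWithin_of_tendsto_nhds (continuous_fst.tendsto _))
      (tendsto_nhdsWithin_of_tendsto_nhds (continuous_snd.tendsto _))
      eventually_mem_nhdsWithin ?_
    rwa [sub_self, norm_zero]
  obtain ⟨u, v, hu, hbu, hv, hbv, huv⟩ := mem_nhds_prod_iff'.1 (eventually_nhdsWithin_iff.1 h)
  refine ⟨u ∩ v, hu.inter hv, ⟨hbu, hbv⟩, fun x a c ha hc => ?_⟩
  rw [Fiber.norm_sub_eq]
  exact huv (Set.mk_mem_prod ha.1 hc.2) (a.2.trans c.2.symm)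

lemma isOpen_combination {W₁ W₂ : Set Ω.T} (h₁ : IsOpen W₁) (h₂ : IsOpen W₂) {c d : Ω.G → ℂ}
    (hc : Continuous c) (hd : Continuous d) :
    IsOpen {b | ∃ (x : Ω.G) (b₁ b₂ : Ω.Fiber x),
      c x ≠ 0 ∧ b₁.1 ∈ W₁ ∧ b₂.1 ∈ W₂ ∧ b = (c x • b₁ + d x • b₂).1} := by
  rw [isOpen_iff_mem_nhds]
  rintro _ ⟨x, b₁, b₂, hcx, hb₁, hb₂, rfl⟩
  set b₀ := c x • b₁ + d x • b₂ with hb₀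
  let Z : Set (Ω.T × Ω.T) := {q | Ω.p q.1 = Ω.p q.2}
  let F : Ω.T × Ω.T → Ω.T := fun q =>
    Ω.bsmul (c (Ω.p q.1))⁻¹ (Ω.badd q.1 (Ω.bsmul (-d (Ω.p q.1)) q.2))
  have hfst : Tendsto Prod.fst (𝓝[Z] (b₀.1, b₂.1)) (𝓝 b₀.1) :=
    tendsto_nhdsWithin_of_tendsto_nhds (continuous_fst.tendsto _)
  have hsnd : Tendsto Prod.snd (𝓝[Z] (b₀.1, b₂.1)) (𝓝 b₂.1) :=
    tendsto_nhdsWithin_of_tendsto_nhds (continuous_snd.tendsto _)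
  have hp : Tendsto (fun q : Ω.T × Ω.T => Ω.p q.1) (𝓝[Z] (b₀.1, b₂.1)) (𝓝 x) := by
    have h := (Ω.p_cont.tendsto b₀.1).comp hfst
    rwa [b₀.2] at h
  have hb₁_eq : b₁.1 = Ω.bsmul (c x)⁻¹ (Ω.badd b₀.1 (Ω.bsmul (-d x) b₂.1)) := by
    have : b₁ = (c x)⁻¹ • (b₀ + (-d x) • b₂) := by
      rw [hb₀, neg_smul, add_neg_cancel_right, inv_smul_smul₀ hcx]
    exact congrArg Fiber.val this
  have hF : Tendsto F (𝓝[Z] (b₀.1, b₂.1)) (𝓝 b₁.1) := by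
    rw [hb₁_eq]
    refine tendsto_bsmul (((hc.tendsto x).comp hp).inv₀ hcx)
      (tendsto_badd hfst (tendsto_bsmul ((hd.tendsto x).comp hp).neg hsnd) ?_ ?_)
    · simp only [Ω.p_bsmul]
      exact eventually_mem_nhdsWithin
    · rw [Ω.p_bsmul, b₀.2, b₂.2]
  obtain ⟨u, v, hu, hbu, hv, hbv, huv⟩ :=
    mem_nhds_prod_iff'.1 (eventually_nhdsWithin_iff.1 (hF.eventually (h₁.mem_nhds hb₁)))
  have hpv : Ω.p ⁻¹' (Ω.p '' (v ∩ W₂)) ∈ 𝓝 b₀.1 :=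
    ((Ω.p_open _ (hv.inter h₂)).preimage Ω.p_cont).mem_nhds
      ⟨b₂.1, ⟨hbv, hb₂⟩, b₂.2.trans b₀.2.symm⟩
  have hcp : ∀ᶠ b in 𝓝 b₀.1, c (Ω.p b) ≠ 0 :=
    (hc.comp Ω.p_cont).continuousAt.eventually_ne (by simpa [b₀.2] using hcx)
  filter_upwards [hu.mem_nhds hbu, hpv, hcp] with b hb ⟨e, he, hpe⟩ hcb
  let b' : Ω.Fiber (Ω.p b) := ⟨b, rfl⟩
  let e' : Ω.Fiber (Ω.p b) := ⟨e, hpe⟩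
  refine ⟨Ω.p b, (c (Ω.p b))⁻¹ • (b' + (-d (Ω.p b)) • e'), e', hcb,
    huv (Set.mk_mem_prod hb he.1) hpe.symm, he.2, ?_⟩
  rw [smul_inv_smul₀ hcb, neg_smul, neg_add_cancel_right]

lemma Fiber.norm_combination_sub_lt {x : Ω.G} {a₁ a₂ b₁ b₂ : Ω.Fiber x} {t δ : ℝ}
    (ht : t ∈ Set.Icc (0 : ℝ) 1) (h₁ : t ≠ 0 → ‖a₁ - b₁‖ < δ) (h₂ : t ≠ 1 → ‖a₂ - b₂‖ < δ) :
    ‖((t : ℂ) • a₁ + (1 - t : ℂ) • a₂) - ((t : ℂ) • b₁ + (1 - t : ℂ) • b₂)‖ < δ := by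
  rcases eq_or_ne t 0 with rfl | h0
  · simpa using h₂ zero_ne_one
  rcases eq_or_ne t 1 with rfl | h1
  · simpa using h₁ one_ne_zero
  have ht0 : 0 < t := lt_of_le_of_ne ht.1 h0.symm
  have ht1 : 0 < 1 - t := sub_pos.2 (lt_of_le_of_ne ht.2 h1)
  have hn : ‖(1 - t : ℂ)‖ = 1 - t := by
    rw [← Complex.ofReal_one, ← Complex.ofReal_sub, Complex.norm_of_nonneg ht1.le]
  calc ‖((t : ℂ) • a₁ + (1 - t : ℂ) • a₂) - ((t : ℂ) • b₁ + (1 - t : ℂ) • b₂)‖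
      = ‖(t : ℂ) • (a₁ - b₁) + (1 - t : ℂ) • (a₂ - b₂)‖ := by
        congr 1
        module
    _ ≤ t * ‖a₁ - b₁‖ + (1 - t) * ‖a₂ - b₂‖ := by
        refine (norm_add_le _ _).trans_eq ?_
        rw [norm_smul, norm_smul, hn, Complex.norm_of_nonneg ht.1]
    _ < t * δ + (1 - t) * δ :=
        add_lt_add (mul_lt_mul_of_pos_left (h₁ h0) ht0) (mul_lt_mul_of_pos_left (h₂ h1) ht1)
    _ = δ := by ring

lemma Fiber.combination_self {x : Ω.G} (t : ℂ) (a : Ω.Fiber x) : t • a + (1 - t) • a = a := by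
  module

lemma exists_near_union {O W₁ W₂ : Set Ω.T} {η δ : ℝ} {K₁ K₂ : Set Ω.G} (hK₁ : IsCompact K₁)
    (hW₁ : IsOpen W₁) (hKW₁ : K₁ ⊆ Ω.p '' W₁) (hδ₁ : Near W₁ W₁ δ) (hη₁ : Near W₁ O η)
    (hW₂ : IsOpen W₂) (hKW₂ : K₂ ⊆ Ω.p '' W₂) (hδ₂ : Near W₂ W₂ δ) (hη₂ : Near W₂ O η) :
    ∃ W, IsOpen W ∧ K₁ ∪ K₂ ⊆ Ω.p '' W ∧ Near W W δ ∧ Near W O η := by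
  have := Ω.t2G
  have := Ω.lcG
  obtain ⟨f, hf1, hf0, -, -⟩ := exists_continuous_one_zero_of_isCompact hK₁
    (Ω.p_open _ hW₁).isClosed_compl (Set.disjoint_compl_right_iff_subset.2 hKW₁)
  let φ : Ω.G → ℝ := fun x => max 0 (min 1 (3 * f x - 1))
  have hφ : Continuous φ := by fun_prop
  have hφI : ∀ x, φ x ∈ Set.Icc (0 : ℝ) 1 := fun x =>
    ⟨le_max_left _ _, max_le zero_le_one (min_le_left _ _)⟩
  have hφ1 : ∀ x, 2 / 3 < f x → φ x = 1 := fun x hx => by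
    have : min 1 (3 * f x - 1) = 1 := min_eq_left (by linarith)
    simp only [φ, this]
    exact max_eq_right zero_le_one
  have hφ0 : ∀ x, f x < 1 / 3 → φ x = 0 := fun x hx =>
    max_eq_left ((min_le_right _ _).trans (by linarith))
  have hφc : Continuous fun x => (φ x : ℂ) := Complex.continuous_ofReal.comp hφ
  have hφc' : Continuous fun x => (1 - φ x : ℂ) := continuous_const.sub hφc
  let A : Set Ω.T := W₁ ∩ Ω.p ⁻¹' {x | 2 / 3 < f x}
  let B : Set Ω.T := W₂ ∩ Ω.p ⁻¹' {x | f x < 1 / 3}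
  let C : Set Ω.T := {b | ∃ (x : Ω.G) (b₁ b₂ : Ω.Fiber x), b₁.1 ∈ W₁ ∧ b₂.1 ∈ W₂ ∧
    b = ((φ x : ℂ) • b₁ + (1 - φ x : ℂ) • b₂).1}
  have hA : IsOpen A := hW₁.inter ((isOpen_lt continuous_const f.continuous).preimage Ω.p_cont)
  have hB : IsOpen B := hW₂.inter ((isOpen_lt f.continuous continuous_const).preimage Ω.p_cont)
  have hC : IsOpen C := by
    convert (isOpen_combination hW₁ hW₂ hφc hφc').union
      (isOpen_combination hW₂ hW₁ hφc' hφc) using 1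
    ext b
    constructor
    · rintro ⟨x, b₁, b₂, h₁, h₂, rfl⟩
      by_cases h : (φ x : ℂ) = 0
      · exact Or.inr ⟨x, b₂, b₁, by simp [h], h₂, h₁, by rw [add_comm]⟩
      · exact Or.inl ⟨x, b₁, b₂, h, h₁, h₂, rfl⟩
    · rintro (⟨x, b₁, b₂, -, h₁, h₂, rfl⟩ | ⟨x, b₂, b₁, -, h₂, h₁, rfl⟩)
      · exact ⟨x, b₁, b₂, h₁, h₂, rfl⟩
      · exact ⟨x, b₁, b₂, h₁, h₂, by rw [add_comm]⟩
  have key : ∀ ⦃x : Ω.G⦄ (a : Ω.Fiber x), a.1 ∈ A ∪ B ∪ C → ∃ a₁ a₂ : Ω.Fiber x,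
      (φ x ≠ 0 → a₁.1 ∈ W₁) ∧ (φ x ≠ 1 → a₂.1 ∈ W₂) ∧
      a = (φ x : ℂ) • a₁ + (1 - φ x : ℂ) • a₂ := by
    rintro x a ((⟨ha, hx⟩ | ⟨ha, hx⟩) | ⟨y, a₁, a₂, h₁, h₂, h⟩)
    · rw [Set.mem_preimage, a.2] at hx
      exact ⟨a, a, fun _ => ha, fun h => absurd (hφ1 x hx) h, (Fiber.combination_self _ a).symm⟩
    · rw [Set.mem_preimage, a.2] at hx
      exact ⟨a, a, fun h => absurd (hφ0 x hx) h, fun _ => ha, (Fiber.combination_self _ a).symm⟩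
    · obtain rfl : x = y := by rw [← a.2, h, Fiber.p_val]
      exact ⟨a₁, a₂, fun _ => h₁, fun _ => h₂, Fiber.ext h⟩
  refine ⟨A ∪ B ∪ C, (hA.union hB).union hC, ?_, fun x a b ha hb => ?_, fun x a b ha hb => ?_⟩
  · rintro x (hx | hx)
    · obtain ⟨b, hb, rfl⟩ := hKW₁ hx
      refine ⟨b, Or.inl (Or.inl ⟨hb, ?_⟩), rfl⟩
      have : f (Ω.p b) = 1 := hf1 hx
      simp only [Set.mem_preimage, Set.mem_ofPred_eq, this]
      norm_num
    · obtain ⟨b₂, hb₂, rfl⟩ := hKW₂ hx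
      by_cases hlt : f (Ω.p b₂) < 1 / 3
      · exact ⟨b₂, Or.inl (Or.inr ⟨hb₂, hlt⟩), rfl⟩
      · obtain ⟨b₁, hb₁, h⟩ : Ω.p b₂ ∈ Ω.p '' W₁ := by
          by_contra hn
          have : f (Ω.p b₂) = 0 := hf0 hn
          rw [this] at hlt
          norm_num at hlt
        exact ⟨_, Or.inr ⟨Ω.p b₂, ⟨b₁, h⟩, ⟨b₂, rfl⟩, hb₁, hb₂, rfl⟩, Fiber.p_val _⟩
  · obtain ⟨a₁, a₂, ha₁, ha₂, rfl⟩ := key a ha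
    obtain ⟨b₁, b₂, hb₁, hb₂, rfl⟩ := key b hb
    exact Fiber.norm_combination_sub_lt (hφI x) (fun h => hδ₁ _ _ (ha₁ h) (hb₁ h))
      fun h => hδ₂ _ _ (ha₂ h) (hb₂ h)
  · obtain ⟨a₁, a₂, ha₁, ha₂, rfl⟩ := key a ha
    rw [← Fiber.combination_self (φ x : ℂ) b]
    exact Fiber.norm_combination_sub_lt (hφI x) (fun h => hη₁ _ _ (ha₁ h) hb)
      fun h => hη₂ _ _ (ha₂ h) hb

lemma exists_near_refinement {O : Set Ω.T} (hO : IsOpen O) {η δ : ℝ} (hδ : 0 < δ)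
    (hη : Near O O η) {K : Set Ω.G} (hK : IsCompact K) (hKO : K ⊆ Ω.p '' O) :
    ∃ W, IsOpen W ∧ K ⊆ Ω.p '' W ∧ Near W W δ ∧ Near W O η := by
  have := Ω.t2G
  have := Ω.lcG
  have h : ∃ L, IsCompact L ∧ K ⊆ L ∧
      ∃ W, IsOpen W ∧ L ⊆ Ω.p '' W ∧ Near W W δ ∧ Near W O η := by
    refine hK.induction_on (p := fun S => ∃ L, IsCompact L ∧ S ⊆ L ∧
      ∃ W, IsOpen W ∧ L ⊆ Ω.p '' W ∧ Near W W δ ∧ Near W O η) ?_ ?_ ?_ ?_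
    · exact ⟨∅, isCompact_empty, subset_rfl, ∅, isOpen_empty, Set.empty_subset _,
        fun _ _ _ h => h.elim, fun _ _ _ h => h.elim⟩
    · rintro S T hST ⟨L, hL, hTL, h⟩
      exact ⟨L, hL, hST.trans hTL, h⟩
    · rintro S T ⟨L₁, hL₁, hS, W₁, hW₁, hLW₁, hδ₁, hη₁⟩ ⟨L₂, hL₂, hT, W₂, hW₂, hLW₂, hδ₂, hη₂⟩
      exact ⟨L₁ ∪ L₂, hL₁.union hL₂, Set.union_subset_union hS hT,
        exists_near_union hL₁ hW₁ hLW₁ hδ₁ hη₁ hW₂ hLW₂ hδ₂ hη₂⟩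
    · intro x hx
      obtain ⟨b, hb, rfl⟩ := hKO hx
      obtain ⟨U, hU, hbU, hUδ⟩ := exists_isOpen_near_self b hδ
      obtain ⟨L, hL, hLU, hLc⟩ := local_compact_nhds
        ((Ω.p_open _ (hU.inter hO)).mem_nhds ⟨b, ⟨hbU, hb⟩, rfl⟩)
      exact ⟨L, mem_nhdsWithin_of_mem_nhds hL, L, hLc, subset_rfl, U ∩ O, hU.inter hO, hLU,
        hUδ.mono Set.inter_subset_left Set.inter_subset_left,
        hη.mono Set.inter_subset_right subset_rfl⟩
  obtain ⟨L, -, hKL, W, hW, hLW, h⟩ := h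
  exact ⟨W, hW, hKL.trans hLW, h⟩

lemma exists_seq_near {O : Set Ω.T} (hO : IsOpen O) {r : ℝ} (hr : 0 < r) (hOr : Near O O r)
    {K : Set Ω.G} (hK : IsCompact K) (hKO : K ⊆ Ω.p '' O) :
    ∃ W : ℕ → Set Ω.T, W 0 = O ∧ ∀ n, IsOpen (W n) ∧ K ⊆ Ω.p '' W n ∧
      Near (W n) (W n) (r * (1 / 2) ^ n) ∧ Near (W (n + 1)) (W n) (r * (1 / 2) ^ n) := by
  let S : ℕ → Type := fun n =>
    {W : Set Ω.T // IsOpen W ∧ K ⊆ Ω.p '' W ∧ Near W W (r * (1 / 2) ^ n)}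
  have step : ∀ n (W : S n), ∃ W' : S (n + 1), Near W'.1 W.1 (r * (1 / 2) ^ n) := fun n W => by
    obtain ⟨W', h, hKW', hδ, hη⟩ := exists_near_refinement W.2.1
      (δ := r * (1 / 2) ^ (n + 1)) (by positivity) W.2.2.2 hK W.2.2.1
    exact ⟨⟨W', h, hKW', hδ⟩, hη⟩
  choose g hg using step
  let W : ∀ n, S n := fun n => Nat.rec ⟨O, hO, hKO, by simpa using hOr⟩ g n
  exact ⟨fun n => (W n).1, rfl, fun n => ⟨(W n).2.1, (W n).2.2.1, (W n).2.2.2, hg n (W n)⟩⟩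

lemma exists_section_continuousAt_interior (c : Ω.T) {ε : ℝ} (hε : 0 < ε) :
    ∃ (K : Set Ω.G) (s : ∀ x, Ω.Fiber x), IsCompact K ∧ K ∈ 𝓝 (Ω.p c) ∧
      (∀ x ∈ interior K, ContinuousAt (fun y => (s y).1) x) ∧
      ‖s (Ω.p c) - ⟨c, rfl⟩‖ < ε := by
  have := Ω.t2G
  have := Ω.lcG
  obtain ⟨r, hr, hrε⟩ : ∃ r : ℝ, 0 < r ∧ 3 * r = ε := ⟨ε / 3, by positivity, by ring⟩
  obtain ⟨O, hO, hcO, hOr⟩ := exists_isOpen_near_self c hr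
  obtain ⟨K, hKc, hKO, hK⟩ := local_compact_nhds ((Ω.p_open _ hO).mem_nhds ⟨c, hcO, rfl⟩)
  obtain ⟨W, hW0, hW⟩ := exists_seq_near hO hr hOr hK hKO
  have hsel : ∀ n x, ∃ a : Ω.Fiber x, x ∈ K → a.1 ∈ W n := fun n x => by
    by_cases hx : x ∈ K
    · obtain ⟨a, ha, hax⟩ := (hW n).2.1 hx
      exact ⟨⟨a, hax⟩, fun _ => ha⟩
    · exact ⟨0, fun h => absurd h hx⟩
  choose t ht using hsel
  have hstep : ∀ x ∈ K, ∀ n, dist (t n x) (t (n + 1) x) ≤ r * (1 / 2) ^ n := fun x hx n => by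
    rw [dist_comm, dist_eq_norm]
    exact ((hW n).2.2.2 _ _ (ht (n + 1) x hx) (ht n x hx)).le
  have hlim : ∀ x, ∃ L : Ω.Fiber x, x ∈ K → Tendsto (fun n => t n x) atTop (𝓝 L) := fun x => by
    by_cases hx : x ∈ K
    · obtain ⟨L, hL⟩ := cauchySeq_tendsto_of_complete
        (cauchySeq_of_le_geometric (1 / 2) r (by norm_num) (hstep x hx))
      exact ⟨L, fun _ => hL⟩
    · exact ⟨0, fun h => absurd h hx⟩
  choose s hs using hlim
  have hdist : ∀ x ∈ K, ∀ n, ‖s x - t n x‖ ≤ 2 * r * (1 / 2) ^ n := fun x hx n => by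
    rw [← dist_eq_norm, dist_comm]
    refine (dist_le_of_le_geometric_of_tendsto (1 / 2) r (by norm_num) (hstep x hx)
      (hs x hx) n).trans_eq ?_
    ring
  refine ⟨K, s, hK, hKc, fun x hx => ?_, ?_⟩
  · refine tendsto_def.2 fun N hN => ?_
    have hadd : ∀ᶠ q in 𝓝 ((s x).1, Ω.bzero x),
        Ω.p q.1 = Ω.p q.2 → Ω.badd q.1 q.2 ∈ N := by
      refine eventually_nhdsWithin_iff.1 ((Ω.continuousOn_badd ((s x).1, Ω.bzero x)
        ((s x).2.trans (Ω.p_bzero x).symm)).tendsto.eventually ?_)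
      have : Ω.badd (s x).1 (Ω.bzero x) = (s x).1 := congrArg Fiber.val (add_zero (s x))
      rwa [this]
    obtain ⟨M, Z, hM, hsM, hZ, hxZ, hMZ⟩ := mem_nhds_prod_iff'.1 hadd
    obtain ⟨V, hV, δ, hδ, hVδ⟩ := Ω.zero_nbhd x Z (hZ.mem_nhds hxZ)
    obtain ⟨δ', hδ', hMδ⟩ := Ω.norm_nbhd_fiber (s x).1 M (hM.mem_nhds hsM)
    obtain ⟨n, hn⟩ := exists_pow_lt_of_lt_one
      (show 0 < min δ δ' / (3 * r) by positivity) (show (1 / 2 : ℝ) < 1 by norm_num)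
    rw [lt_div_iff₀ (by positivity)] at hn
    have hpow : 0 < r * (1 / 2 : ℝ) ^ n := by positivity
    have hxK := interior_subset hx
    have htM : (t n x).1 ∈ M := by
      refine hMδ _ ((t n x).2.trans (s x).2.symm) ?_
      rw [← Fiber.norm_sub_eq, norm_sub_rev]
      linarith [hdist x hxK n, min_le_right δ δ']
    have hpM : Ω.p '' (M ∩ W n) ∈ 𝓝 x :=
      (Ω.p_open _ (hM.inter (hW n).1)).mem_nhds ⟨_, ⟨htM, ht n x hxK⟩, (t n x).2⟩
    filter_upwards [hpM, hV, mem_interior_iff_mem_nhds.1 hx] with y ⟨a, ⟨haM, haW⟩, hay⟩ hyV hyK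
    let a' : Ω.Fiber y := ⟨a, hay⟩
    have hsmall : ‖s y - a'‖ < δ := by
      have h1 : ‖t n y - a'‖ < r * (1 / 2) ^ n := (hW n).2.2.1 _ _ (ht n y hyK) haW
      have h2 := norm_sub_le_norm_sub_add_norm_sub (s y) (t n y) a'
      linarith [hdist y hyK n, min_le_left δ δ']
    have hz : (s y - a').1 ∈ Z := hVδ _ (by rwa [Fiber.p_val]) hsmall
    have hsum : (s y).1 = Ω.badd a (s y - a').1 :=
      congrArg Fiber.val (add_sub_cancel a' (s y)).symm
    rw [Set.mem_preimage, hsum]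
    exact hMZ (Set.mk_mem_prod haM hz) (hay.trans (Fiber.p_val _).symm)
  · have hcK := mem_of_mem_nhds hKc
    have h0 : ‖t 0 (Ω.p c) - ⟨c, rfl⟩‖ < r := hOr _ _ (hW0 ▸ ht 0 _ hcK) hcO
    have h1 := hdist _ hcK 0
    have h2 := norm_sub_le_norm_sub_add_norm_sub (s (Ω.p c)) (t 0 (Ω.p c)) ⟨c, rfl⟩
    rw [pow_zero] at h1
    linarith

/-- The bundle has enough compactly supported continuous sections. -/
lemma exists_continuous_section (c : Ω.T) {ε : ℝ} (hε : 0 < ε) :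
    ∃ (K : Set Ω.G) (s : ∀ x, Ω.Fiber x), IsCompact K ∧ Continuous (fun x => (s x).1) ∧
      (∀ x ∉ K, s x = 0) ∧ ‖s (Ω.p c) - ⟨c, rfl⟩‖ < ε := by
  have := Ω.t2G
  have := Ω.lcG
  obtain ⟨K, s, hK, hKc, hs, hsc⟩ := exists_section_continuousAt_interior c hε
  obtain ⟨f, hf1, hf0, -, -⟩ := exists_continuous_one_zero_of_isCompact
    (isCompact_singleton (x := Ω.p c)) (isOpen_interior (s := K)).isClosed_compl
    (Set.disjoint_compl_right_iff_subset.2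
      (Set.singleton_subset_iff.2 (mem_interior_iff_mem_nhds.2 hKc)))
  let φ : Ω.G → ℝ := fun x => max 0 (2 * f x - 1)
  have hφ : Continuous φ := by fun_prop
  have hφ0 : ∀ x, f x < 1 / 2 → φ x = 0 := fun x hx => max_eq_left (by linarith)
  have hφK : ∀ x ∉ interior K, f x < 1 / 2 := fun x hx => by
    have : f x = 0 := hf0 hx
    rw [this]
    norm_num
  refine ⟨K, fun x => (φ x : ℂ) • s x, hK, continuous_iff_continuousAt.2 fun x => ?_,
    fun x hx => ?_, ?_⟩
  · by_cases hx : x ∈ interior K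
    · exact tendsto_bsmul ((Complex.continuous_ofReal.comp hφ).tendsto x) (hs x hx)
    · refine Ω.cont_bzero.continuousAt.congr ?_
      filter_upwards [(isOpen_lt f.continuous continuous_const).mem_nhds (hφK x hx)] with y hy
      simp only [hφ0 y hy, Complex.ofReal_zero, zero_smul, Fiber.val_zero]
  · simp only [hφ0 x (hφK x fun h => hx (interior_subset h)), Complex.ofReal_zero, zero_smul]
  · have h1 : f (Ω.p c) = 1 := hf1 rfl
    have : φ (Ω.p c) = 1 := by
      simp only [φ, h1]
      norm_num
    simpa only [this, Complex.ofReal_one, one_smul] using hsc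

lemma isClosed_units : IsClosed {x : Ω.G | Ω.rng x = x} := by
  have := Ω.t2G
  have h : Continuous Ω.rng := by
    have := Ω.cont_gmul.comp (f := fun x : Ω.G => ⟨(x, Ω.ginv x), (Ω.rng_ginv x).symm⟩)
      ((continuous_id.prodMk Ω.cont_ginv).subtype_mk _)
    exact this.congr Ω.gmul_ginv
  exact isClosed_eq h continuous_id

/-- Restricting a compactly supported section to the unit space gives an element of `A`. -/
lemma isA_restrict {K : Set Ω.G} (hK : IsCompact K) {s : ∀ x, Ω.Fiber x}
    (hs : Continuous fun x => (s x).1) (hsK : ∀ x ∉ K, s x = 0) :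
    Ω.IsA fun u => (s u.1).1 := by
  refine ⟨fun u => (s u.1).2, hs.comp continuous_subtype_val, fun ε hε =>
    ⟨Subtype.val ⁻¹' K, isClosed_units.isClosedEmbedding_subtypeVal.isCompact_preimage hK,
      fun u hu => ?_⟩⟩
  rw [← Fiber.norm_def, hsK u.1 hu, norm_zero]
  exact hε

lemma continuousOn_bnorm_units
    (h : ∀ σ : Ω.toLCGroupoid.UnitSpace → Ω.T, Ω.IsA σ → Continuous fun u => Ω.bnorm (σ u)) :
    ContinuousOn Ω.bnorm {b | Ω.rng (Ω.p b) = Ω.p b} := by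
  intro b hb
  refine continuousWithinAt_iff_lower_upperSemicontinuousWithinAt.2
    ⟨fun m hm => ?_, Ω.usc_bnorm.upperSemicontinuousWithinAt _ _⟩
  obtain ⟨ε, hε, hεm⟩ : ∃ ε : ℝ, 0 < ε ∧ m + 2 * ε = Ω.bnorm b :=
    ⟨(Ω.bnorm b - m) / 2, half_pos (sub_pos.2 hm), by ring⟩
  obtain ⟨K, s, hK, hs, hsK, hsb⟩ := exists_continuous_section b hε
  have hnorm : ContinuousOn (fun x => ‖s x‖) {x : Ω.G | Ω.rng x = x} :=
    continuousOn_iff_continuous_domRestrict.2 (h _ (isA_restrict hK hs hsK))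
  have hlow : ∀ᶠ c in 𝓝[{b | Ω.rng (Ω.p b) = Ω.p b}] b, m + ε < ‖s (Ω.p c)‖ := by
    refine ((hnorm (Ω.p b) hb).tendsto.comp ((Ω.p_cont.continuousWithinAt).tendsto_nhdsWithin
      fun c hc => hc)).eventually (lt_mem_nhds ?_)
    have h1 : ‖(⟨b, rfl⟩ : Ω.Fiber (Ω.p b))‖ ≤ _ := norm_le_norm_add_norm_sub (s (Ω.p b)) _
    have h2 : ‖(⟨b, rfl⟩ : Ω.Fiber (Ω.p b))‖ = Ω.bnorm b := rfl
    linarith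
  have hclose := eventually_norm_sub_lt (l := 𝓝[{b | Ω.rng (Ω.p b) = Ω.p b}] b)
    (tendsto_nhdsWithin_of_tendsto_nhds ((hs.comp Ω.p_cont).tendsto b))
    (tendsto_nhdsWithin_of_tendsto_nhds (continuous_id.tendsto b))
    (Eventually.of_forall fun c => (s (Ω.p c)).2) hsb
  filter_upwards [hlow, hclose] with c hc hc'
  let c' : Ω.Fiber (Ω.p c) := ⟨c, rfl⟩
  have h1 : ‖s (Ω.p c) - c'‖ < ε := (Fiber.norm_sub_eq _ _).trans_lt hc'
  have h2 : ‖s (Ω.p c)‖ - ‖c'‖ ≤ _ := norm_sub_norm_le (s (Ω.p c)) c'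
  have h3 : ‖c'‖ = Ω.bnorm c := rfl
  linarith

lemma continuous_bnorm_of_continuousOn_units
    (h : ContinuousOn Ω.bnorm {b | Ω.rng (Ω.p b) = Ω.p b}) : Continuous Ω.bnorm := by
  have hcomp : ∀ b, Ω.src (Ω.p (Ω.bstar b)) = Ω.rng (Ω.p b) := fun b => by
    rw [Ω.p_bstar, Ω.src_ginv]
  have hpair : Continuous fun b =>
      (⟨(Ω.bstar b, b), hcomp b⟩ : {q : Ω.T × Ω.T // Ω.src (Ω.p q.1) = Ω.rng (Ω.p q.2)}) :=
    (Ω.cont_bstar.prodMk continuous_id).subtype_mk _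
  have hmul : Continuous fun b => Ω.bmul (Ω.bstar b) b := Ω.cont_bmul.comp hpair
  have hunit : ∀ b, Ω.bmul (Ω.bstar b) b ∈ {b | Ω.rng (Ω.p b) = Ω.p b} := fun b => by
    rw [Set.mem_ofPred_eq, Ω.p_bmul _ _ (hcomp b), Ω.p_bstar, Ω.ginv_gmul, Ω.rng_src]
  refine (h.comp_continuous hmul hunit).sqrt.congr fun b => ?_
  rw [Function.comp_apply, Ω.cstar_identity, Real.sqrt_sq (Ω.bnorm_nonneg b)]

end FellBundleData

/-- For a Fell bundle `p : B → G` over a locally compact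
Hausdorff groupoid with `A := Γ₀(G⁰; B)` the C*-algebra over the unit space, the
underlying Banach bundle is continuous (the norm is continuous on the total
space) if and only if `A` is a continuous `C₀(G⁰)`-algebra, i.e. iff
`u ↦ ‖q_u(a)‖ = ‖a(u)‖` is continuous on `G⁰` for every `a ∈ A`. -/
theorem fellBundle_continuous_iff_sections_continuous (Ω : FellBundle) :
    Continuous Ω.bnorm ↔
      ∀ σ : Ω.toLCGroupoid.UnitSpace → Ω.T, Ω.IsA σ →
        Continuous fun u => Ω.bnorm (σ u) := by
  exact ⟨fun h σ hσ => h.comp hσ.2.1, fun h =>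
    FellBundleData.continuous_bnorm_of_continuousOn_units
      (FellBundleData.continuousOn_bnorm_units h)⟩
end
end

section
/- Let p: B → G be a Fell bundle over a locally compact Hausdorff groupoid G and A := Γ₀(G⁰; B). Then the Rieffel correspondences satisfy h_x ∘ h_y = h_{xy} for every composable pair (x,y) ∈ G⁽²⁾, and h_u is the identity on Prim A(u) for every unit u ∈ G⁰. Consequently, the formula x·(s(x), P) := (r(x), h_x(P)) defines an action of G on Prim A = {(u,P) : u ∈ G⁰, P ∈ Prim A(u)}. -/
noncomputable section

open Filter
open scoped Topology

theorem Complex.le_norm_of_ofReal_eq {r : ℝ} {z : ℂ} (h : (r : ℂ) = z) : r ≤ ‖z‖ := by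
  rw [← h, Complex.norm_real]
  exact le_abs_self r

/-- A self-adjoint power sequence argument: if `m 0, m 1, …` is a nonnegative log-convex sequence
with geometric growth rate at most `M`, then `m 1 ≤ M * m 0`. -/
theorem le_mul_of_sq_le_of_geometric_bound {m : ℕ → ℝ} {C M : ℝ} (hm : ∀ k, 0 ≤ m k)
    (hM : 0 ≤ M) (hsq : ∀ k, m k ^ 2 ≤ m (2 * k) * m 0) (hC : ∀ k, m k ≤ C * M ^ k) :
    m 1 ≤ M * m 0 := by
  rcases (hm 0).eq_or_lt with h0 | h0
  · have := hsq 1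
    rw [← h0, mul_zero] at this
    rw [← h0, mul_zero]
    exact (pow_eq_zero_iff two_ne_zero).1 (le_antisymm this (sq_nonneg _)) |>.le
  have key : ∀ n : ℕ, m 1 ^ 2 ^ n * m 0 ≤ m (2 ^ n) * m 0 ^ 2 ^ n := by
    intro n
    induction n with
    | zero => simp
    | succ n ih =>
      have h1 : (m 1 ^ 2 ^ n * m 0) ^ 2 ≤ (m (2 ^ n) * m 0 ^ 2 ^ n) ^ 2 :=
        pow_le_pow_left₀ (mul_nonneg (pow_nonneg (hm 1) _) h0.le) ih 2
      have h2 := hsq (2 ^ n)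
      have h3 : (m (2 ^ n) * m 0 ^ 2 ^ n) ^ 2 ≤
          m (2 * 2 ^ n) * m 0 * (m 0 ^ 2 ^ n) ^ 2 := by
        rw [mul_pow]
        exact mul_le_mul_of_nonneg_right h2 (sq_nonneg _)
      have h4 := h1.trans h3
      rw [pow_succ, mul_comm (2 ^ n) 2]
      refine le_of_mul_le_mul_right (a := m 0) ?_ h0
      calc m 1 ^ (2 * 2 ^ n) * m 0 * m 0 = (m 1 ^ 2 ^ n * m 0) ^ 2 := by ring
        _ ≤ _ := h4
        _ = _ := by ring
  by_contra! hlt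
  have hm1 : 0 < m 1 := lt_of_le_of_lt (mul_nonneg hM h0.le) hlt
  rcases hM.eq_or_lt with hM0 | hM0
  · have := hC 1
    rw [← hM0] at this
    simp only [pow_one, mul_zero] at this
    linarith
  set q := m 1 / (M * m 0) with hq
  have hMm : 0 < M * m 0 := mul_pos hM0 h0
  have hq1 : 1 < q := (one_lt_div hMm).2 hlt
  have hb : ∀ n : ℕ, q ^ 2 ^ n ≤ C / m 0 := by
    intro n
    rw [hq, div_pow, div_le_div_iff₀ (pow_pos hMm _) h0]
    calc m 1 ^ 2 ^ n * m 0 ≤ m (2 ^ n) * m 0 ^ 2 ^ n := key n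
      _ ≤ C * M ^ 2 ^ n * m 0 ^ 2 ^ n := by gcongr; exact hC _
      _ = C * (M * m 0) ^ 2 ^ n := by rw [mul_pow]; ring
  obtain ⟨n, hn⟩ := pow_unbounded_of_one_lt (C / m 0) hq1
  exact absurd (hb n) (not_le.2 (hn.trans_le (pow_le_pow_right₀ hq1.le Nat.lt_two_pow_self.le)))

/-- A continuous linear map sending `S` into a closed subspace `J` sends the closed span of `S`
into `J`. -/
theorem map_mem_of_mem_closure_span {E F : Type*} [SeminormedAddCommGroup E] [NormedSpace ℂ E]
    [SeminormedAddCommGroup F] [NormedSpace ℂ F] (f : E →ₗ[ℂ] F) (hf : Continuous f) {S : Set E}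
    {J : Submodule ℂ F} (hJ : IsClosed (J : Set F)) (h : ∀ s ∈ S, f s ∈ J) {a : E}
    (ha : a ∈ closure (Submodule.span ℂ S : Set E)) : f a ∈ J := by
  have h1 : Submodule.span ℂ S ≤ J.comap f := Submodule.span_le.2 h
  exact closure_minimal (t := f ⁻¹' J) h1 (hJ.preimage hf) ha

/-- An element of a C*-algebra lies in a closed subset containing all of its two-sided
multiples. -/
theorem mem_of_forall_mul_mul_mem {A : Type*} [NonUnitalCStarAlgebra A] {J : Set A}
    (hJ : IsClosed J) {c : A} (h : ∀ d e, d * c * e ∈ J) : c ∈ J := by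
  let _ := CStarAlgebra.spectralOrder A
  have := CStarAlgebra.spectralOrderedRing A
  have hu := CStarAlgebra.increasingApproximateUnit A
  have h1 : ∀ d, d * c ∈ J := fun d =>
    hJ.mem_of_tendsto (hu.tendsto_mul_left (d * c)) (Eventually.of_forall fun e => h d e)
  exact hJ.mem_of_tendsto (hu.tendsto_mul_right c) (Eventually.of_forall h1)

theorem NonUnitalStarAlgHom.continuous_of_cstar {A B : Type*} [NonUnitalCStarAlgebra A]
    [NonUnitalCStarAlgebra B] (f : A →⋆ₙₐ[ℂ] B) : Continuous f :=
  AddMonoidHomClass.continuous_of_bound f 1 fun a => by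
    simpa using NonUnitalStarAlgHom.norm_apply_le f a

/-- An irreducible representation is faithful on products: `π e` vanishes as soon as
`π e * π d` kills a fixed nonzero vector for every `d`. -/
theorem NonUnitalStarAlgHom.eq_zero_of_forall_mul_apply_eq_zero {B H : Type*}
    [NonUnitalCStarAlgebra B] [NormedAddCommGroup H] [InnerProductSpace ℂ H] [CompleteSpace H]
    (π : B →⋆ₙₐ[ℂ] (H →L[ℂ] H))
    (hirr : ∀ K : Submodule ℂ H, IsClosed (K : Set H) → (∀ b, ∀ v ∈ K, π b v ∈ K) →
      K = ⊥ ∨ K = ⊤)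
    {ξ : H} (hξ : ξ ≠ 0) {e : B} (he : ∀ d, π e (π d ξ) = 0) (he' : π e ξ = 0) : π e = 0 := by
  let K : Submodule ℂ H := LinearMap.ker (π e).toLinearMap ⊓
    ⨅ d, LinearMap.ker ((π e).comp (π d)).toLinearMap
  have hK : ∀ v, v ∈ K ↔ π e v = 0 ∧ ∀ d, π e (π d v) = 0 := by
    intro v; simp [K, Submodule.mem_iInf]
  have hcl : IsClosed (K : Set H) := by
    have : (K : Set H) = {v | π e v = 0} ∩ ⋂ d, {v | π e (π d v) = 0} := by
      ext v; simp [hK]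
    rw [this]
    exact (isClosed_eq (π e).continuous continuous_const).inter <| isClosed_iInter fun d =>
      isClosed_eq ((π e).continuous.comp (π d).continuous) continuous_const
  rcases hirr K hcl (fun b v hv => (hK _).2 ⟨((hK v).1 hv).2 b, fun d => by
      have := ((hK v).1 hv).2 (d * b)
      rwa [map_mul] at this⟩) with h | h
  · exact absurd ((Submodule.mem_bot ℂ).1 (h ▸ (hK ξ).2 ⟨he', he⟩)) hξ
  · ext v
    exact ((hK v).1 (h ▸ Submodule.mem_top)).1

/-- The algebraic data of an `A`–`B` imprimitivity bimodule `X`. -/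
structure ImprimitivityData (A B X : Type*) [NonUnitalCStarAlgebra A] [NonUnitalCStarAlgebra B]
    [AddCommGroup X] [Module ℂ X] where
  /-- the left action of `A` -/
  lact : A →ₗ[ℂ] X →ₗ[ℂ] X
  /-- the right action of `B` -/
  ract : X → B → X
  /-- the `A`-valued inner product -/
  linner : X → X → A
  /-- the `B`-valued inner product -/
  rinner : X →ₗ⋆[ℂ] X →ₗ[ℂ] B
  lact_mul : ∀ c d a, lact (c * d) a = lact c (lact d a)
  lact_linner : ∀ a b c, lact (linner a b) c = ract a (rinner b c)
  ract_ract : ∀ a d e, ract (ract a d) e = ract a (d * e)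
  linner_mul_mul_linner : ∀ a b c a' b',
    linner a b * c * linner a' b' = linner (ract a (rinner b (lact c a'))) b'
  lact_ract : ∀ c a d, lact c (ract a d) = ract (lact c a) d
  rinner_lact : ∀ a b c, rinner (lact c a) b = rinner a (lact (star c) b)
  rinner_ract : ∀ a b d, rinner a (ract b d) = rinner a b * d
  star_rinner : ∀ a b, star (rinner a b) = rinner b a
  rinner_self : ∀ a, ∃ c, rinner a a = star c * c
  rinner_bound : ∀ a, ∃ C, ∀ c, ‖rinner a (lact c a)‖ ≤ C * ‖c‖
  dense_linner : Dense (Submodule.span ℂ {c | ∃ a b, c = linner a b} : Set A)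
  dense_rinner : Dense (Submodule.span ℂ {c | ∃ a b, c = rinner a b} : Set B)

namespace ImprimitivityData

variable {A B X H : Type*} [NonUnitalCStarAlgebra A] [NonUnitalCStarAlgebra B]
  [AddCommGroup X] [Module ℂ X] [NormedAddCommGroup H] [InnerProductSpace ℂ H] [CompleteSpace H]
  (M : ImprimitivityData A B X) (π : B →⋆ₙₐ[ℂ] (H →L[ℂ] H)) (ξ : H)

theorem rinner_mul_rinner (a b c d : X) :
    M.rinner a b * M.rinner c d = M.rinner a (M.lact (M.linner b c) d) := by
  rw [M.lact_linner, M.rinner_ract]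

/-- The bimodule `X` with the semi-inner product `⟪a, b⟫ = ⟪ξ, π(⟨a, b⟩_B) ξ⟫`; this is the copy
`X ⊗ ξ` of `X` inside the induced representation space `X ⊗_B H`. -/
def PreInd (_M : ImprimitivityData A B X) (_π : B →⋆ₙₐ[ℂ] (H →L[ℂ] H)) (_ξ : H) : Type _ := X

instance : AddCommGroup (M.PreInd π ξ) := inferInstanceAs (AddCommGroup X)
instance : Module ℂ (M.PreInd π ξ) := inferInstanceAs (Module ℂ X)

/-- The identity map from `X` to `M.PreInd π ξ`. -/
def toPreInd : X ≃ₗ[ℂ] M.PreInd π ξ := LinearEquiv.refl ℂ X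

theorem inner_map_star (b : B) (v w : H) : inner ℂ v (π (star b) w) = inner ℂ (π b v) w := by
  rw [map_star, ContinuousLinearMap.star_eq_adjoint, ContinuousLinearMap.adjoint_inner_right]

/-- The semi-inner product on `M.PreInd π ξ`. -/
abbrev preIndCore : PreInnerProductSpace.Core ℂ (M.PreInd π ξ) where
  inner a b := inner ℂ ξ
    (π (M.rinner ((M.toPreInd π ξ).symm a) ((M.toPreInd π ξ).symm b)) ξ)
  conj_inner_symm a b := by
    rw [inner_conj_symm, ← inner_map_star, M.star_rinner]
  re_inner_nonneg a := by
    obtain ⟨c, hc⟩ := M.rinner_self ((M.toPreInd π ξ).symm a)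
    rw [hc, map_mul, mul_apply_eq_comp, inner_map_star]
    exact inner_self_nonneg
  add_left a b c := by simp
  smul_left a b r := by simp

instance : SeminormedAddCommGroup (M.PreInd π ξ) :=
  InnerProductSpace.Core.toSeminormedAddCommGroup (c := M.preIndCore π ξ)
instance : InnerProductSpace ℂ (M.PreInd π ξ) :=
  InnerProductSpace.ofCore (M.preIndCore π ξ)

theorem inner_toPreInd (a b : X) : inner ℂ (M.toPreInd π ξ a) (M.toPreInd π ξ b) =
    inner ℂ ξ (π (M.rinner a b) ξ) := rfl

theorem inner_toPreInd_lact (a b : X) (c : A) :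
    inner ℂ (M.toPreInd π ξ (M.lact c a)) (M.toPreInd π ξ b) =
      inner ℂ (M.toPreInd π ξ a) (M.toPreInd π ξ (M.lact (star c) b)) := by
  rw [inner_toPreInd, inner_toPreInd, M.rinner_lact]

theorem norm_toPreInd_lact_le (a : X) (c : A) :
    ‖M.toPreInd π ξ (M.lact c a)‖ ≤ ‖c‖ * ‖M.toPreInd π ξ a‖ := by
  set j := M.toPreInd π ξ
  let P : ℕ → X := fun k => (fun b => M.lact (star c * c) b)^[k] a
  have hPs : ∀ k, P (k + 1) = M.lact (star c * c) (P k) := fun k =>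
    Function.iterate_succ_apply' _ _ _
  have hsw : ∀ k l, inner ℂ (j (P (k + 1))) (j (P l)) = inner ℂ (j (P k)) (j (P (l + 1))) := by
    intro k l
    rw [hPs, hPs, inner_toPreInd_lact, star_mul, star_star]
  have hadd : ∀ k l, inner ℂ (j (P k)) (j (P l)) = inner ℂ (j a) (j (P (k + l))) := by
    intro k
    induction k with
    | zero => intro l; rw [Nat.zero_add]; rfl
    | succ k ih => intro l; rw [hsw, ih, Nat.succ_add_eq_add_succ]
  let D : ℕ → A := fun k => (fun b => (star c * c) * b)^[k] (star c * c)
  have hDs : ∀ k, D (k + 1) = (star c * c) * D k := fun k => Function.iterate_succ_apply' _ _ _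
  have hDP : ∀ k, P (k + 1) = M.lact (D k) a := by
    intro k
    induction k with
    | zero => rfl
    | succ k ih => rw [hPs, ih, hDs, M.lact_mul _ (D k)]
  have hD : ∀ k, ‖D k‖ ≤ (‖c‖ ^ 2) ^ (k + 1) := by
    intro k
    induction k with
    | zero => simp [D, CStarRing.norm_star_mul_self, sq]
    | succ k ih =>
      rw [hDs, pow_succ']
      refine (norm_mul_le _ _).trans ?_
      rw [CStarRing.norm_star_mul_self, ← sq]
      gcongr
  obtain ⟨C, hC⟩ := M.rinner_bound a
  let m : ℕ → ℝ := fun k => ‖j (P k)‖ ^ 2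
  have hm : ∀ k, ((m k : ℝ) : ℂ) = inner ℂ (j a) (j (P (2 * k))) := by
    intro k
    rw [two_mul, ← hadd, inner_self_eq_norm_sq_to_K]
    simp [m]
  have hsq : ∀ k, m k ^ 2 ≤ m (2 * k) * m 0 := by
    intro k
    have h1 : m k ≤ ‖j a‖ * ‖j (P (2 * k))‖ := by
      exact (Complex.le_norm_of_ofReal_eq (hm k)).trans (norm_inner_le_norm _ _)
    calc m k ^ 2 ≤ (‖j a‖ * ‖j (P (2 * k))‖) ^ 2 := by gcongr
      _ = m (2 * k) * m 0 := by simp only [m]; rw [mul_pow, mul_comm]; rfl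
  have hbd : ∀ k, m k ≤ (|C| * ‖ξ‖ ^ 2 + ‖j a‖ ^ 2) * (‖c‖ ^ 4) ^ k := by
    intro k
    rcases k with _ | k
    · have : 0 ≤ |C| * ‖ξ‖ ^ 2 := by positivity
      simp only [m, pow_zero, mul_one]
      change ‖j a‖ ^ 2 ≤ _
      linarith
    · have h1 : m (k + 1) ≤ ‖ξ‖ * (‖M.rinner a (M.lact (D (2 * k + 1)) a)‖ * ‖ξ‖) := by
        refine (Complex.le_norm_of_ofReal_eq (hm (k + 1))).trans ?_
        rw [show 2 * (k + 1) = 2 * k + 1 + 1 by ring, hDP, inner_toPreInd]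
        refine (norm_inner_le_norm _ _).trans ?_
        gcongr
        refine (ContinuousLinearMap.le_opNorm _ _).trans ?_
        gcongr
        exact NonUnitalStarAlgHom.norm_apply_le π _
      have h2 : ‖M.rinner a (M.lact (D (2 * k + 1)) a)‖ ≤ |C| * (‖c‖ ^ 2) ^ (2 * k + 1 + 1) := by
        refine (hC _).trans ?_
        gcongr
        · exact le_abs_self C
        · exact hD _
      calc m (k + 1) ≤ ‖ξ‖ * ((|C| * (‖c‖ ^ 2) ^ (2 * k + 1 + 1)) * ‖ξ‖) := by
            refine h1.trans ?_
            gcongr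
        _ = |C| * ‖ξ‖ ^ 2 * (‖c‖ ^ 4) ^ (k + 1) := by ring
        _ ≤ _ := by
            gcongr
            have : 0 ≤ ‖j a‖ ^ 2 := by positivity
            linarith
  have hfin := le_mul_of_sq_le_of_geometric_bound (fun k => by positivity) (by positivity) hsq hbd
  have h3 : ‖j (P 1)‖ ≤ ‖c‖ ^ 2 * ‖j a‖ := by
    refine le_of_sq_le_sq ?_ (by positivity)
    calc ‖j (P 1)‖ ^ 2 ≤ ‖c‖ ^ 4 * ‖j a‖ ^ 2 := hfin
      _ = _ := by ring
  have h4 : ‖j (M.lact c a)‖ ^ 2 ≤ ‖j a‖ * ‖j (P 1)‖ := by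
    have : ((‖j (M.lact c a)‖ ^ 2 : ℝ) : ℂ) = inner ℂ (j a) (j (P 1)) := by
      rw [hPs, M.lact_mul, ← inner_toPreInd_lact]
      change _ = inner ℂ (j (M.lact c a)) (j (M.lact c a))
      rw [inner_self_eq_norm_sq_to_K]
      simp
    exact (Complex.le_norm_of_ofReal_eq this).trans (norm_inner_le_norm _ _)
  refine le_of_sq_le_sq ?_ (by positivity)
  calc ‖j (M.lact c a)‖ ^ 2 ≤ ‖j a‖ * (‖c‖ ^ 2 * ‖j a‖) := h4.trans (by gcongr)
    _ = _ := by ring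

/-- The operator on `M.PreInd π ξ` given by the left action of `c`. -/
def preIndLact (c : A) : M.PreInd π ξ →L[ℂ] M.PreInd π ξ :=
  ((M.toPreInd π ξ).toLinearMap ∘ₗ M.lact c ∘ₗ (M.toPreInd π ξ).symm.toLinearMap).mkContinuous ‖c‖
    fun a => M.norm_toPreInd_lact_le π ξ ((M.toPreInd π ξ).symm a) c

/-- The Hilbert space of the induced representation. -/
abbrev Ind : Type _ := UniformSpace.Completion (M.PreInd π ξ)

/-- The canonical map with dense range from `X` to the induced Hilbert space. -/
def toInd (a : X) : M.Ind π ξ := ((M.toPreInd π ξ a : M.PreInd π ξ) : M.Ind π ξ)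

theorem toInd_add (a b : X) : M.toInd π ξ (a + b) = M.toInd π ξ a + M.toInd π ξ b := by
  simp [toInd, UniformSpace.Completion.coe_add]

theorem toInd_smul (z : ℂ) (a : X) : M.toInd π ξ (z • a) = z • M.toInd π ξ a := by
  simp [toInd, UniformSpace.Completion.coe_smul]

theorem inner_toInd (a b : X) :
    inner ℂ (M.toInd π ξ a) (M.toInd π ξ b) = inner ℂ ξ (π (M.rinner a b) ξ) := by
  rw [toInd, toInd, UniformSpace.Completion.inner_coe, inner_toPreInd]

@[elab_as_elim]
theorem ind_induction {p : M.Ind π ξ → Prop} (v : M.Ind π ξ) (hp : IsClosed {v | p v})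
    (h : ∀ a, p (M.toInd π ξ a)) : p v :=
  UniformSpace.Completion.induction_on v hp h

/-- The operator on the induced Hilbert space given by the left action of `c`. -/
def indLact (c : A) : M.Ind π ξ →L[ℂ] M.Ind π ξ := (M.preIndLact π ξ c).completion

theorem indLact_toInd (c : A) (a : X) :
    M.indLact π ξ c (M.toInd π ξ a) = M.toInd π ξ (M.lact c a) :=
  ContinuousLinearMap.completion_apply_coe _ _

theorem ind_ext {T T' : M.Ind π ξ →L[ℂ] M.Ind π ξ}
    (h : ∀ a, T (M.toInd π ξ a) = T' (M.toInd π ξ a)) : T = T' := by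
  refine ContinuousLinearMap.ext fun v => ?_
  induction v using ind_induction with
  | hp => exact isClosed_eq T.continuous T'.continuous
  | h a => exact h a

theorem indLact_smul (z : ℂ) (c : A) : M.indLact π ξ (z • c) = z • M.indLact π ξ c :=
  M.ind_ext π ξ fun a => by
    rw [smul_apply, indLact_toInd, indLact_toInd, map_smul, LinearMap.smul_apply, toInd_smul]

theorem indLact_add (c d : A) : M.indLact π ξ (c + d) = M.indLact π ξ c + M.indLact π ξ d :=
  M.ind_ext π ξ fun a => by
    rw [add_apply, indLact_toInd, indLact_toInd, indLact_toInd, map_add, LinearMap.add_apply,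
      toInd_add]

theorem indLact_mul (c d : A) : M.indLact π ξ (c * d) = M.indLact π ξ c * M.indLact π ξ d :=
  M.ind_ext π ξ fun a => by
    rw [mul_apply_eq_comp, indLact_toInd, indLact_toInd, indLact_toInd, M.lact_mul]

theorem indLact_star (c : A) : M.indLact π ξ (star c) = star (M.indLact π ξ c) := by
  refine (ContinuousLinearMap.eq_adjoint_iff _ _).mpr fun v w => ?_
  induction v using ind_induction with
  | hp => apply isClosed_eq <;> fun_prop
  | h a =>
    induction w using ind_induction with
    | hp => apply isClosed_eq <;> fun_prop
    | h b => rw [indLact_toInd, indLact_toInd, inner_toInd, inner_toInd, M.rinner_lact, star_star]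

/-- The representation of `A` induced from `π`. -/
def ind : A →⋆ₙₐ[ℂ] (M.Ind π ξ →L[ℂ] M.Ind π ξ) where
  toFun := M.indLact π ξ
  map_smul' := M.indLact_smul π ξ
  map_zero' := by simpa using M.indLact_smul π ξ 0 0
  map_add' := M.indLact_add π ξ
  map_mul' := M.indLact_mul π ξ
  map_star' := M.indLact_star π ξ

@[simp]
theorem ind_toInd (c : A) (a : X) : M.ind π ξ c (M.toInd π ξ a) = M.toInd π ξ (M.lact c a) :=
  M.indLact_toInd π ξ c a

/-- The operator `a ⊗ ξ ↦ π(⟨b, a⟩_B) ξ` on `M.PreInd π ξ`. -/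
def preIndEval (b : X) : M.PreInd π ξ →L[ℂ] H :=
  LinearMap.mkContinuous
    { toFun := fun a => π (M.rinner b ((M.toPreInd π ξ).symm a)) ξ
      map_add' := fun a c => by simp
      map_smul' := fun z a => by simp }
    (√‖M.linner b b‖) fun a => by
      set a' := (M.toPreInd π ξ).symm a
      rw [← Real.sqrt_sq (norm_nonneg a), ← Real.sqrt_mul (norm_nonneg _)]
      refine Real.le_sqrt_of_sq_le ?_
      have h : ((‖π (M.rinner b a') ξ‖ ^ 2 : ℝ) : ℂ) =
          inner ℂ (M.toPreInd π ξ a') (M.toPreInd π ξ (M.lact (M.linner b b) a')) := by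
        rw [inner_toPreInd, ← M.rinner_mul_rinner, map_mul, mul_apply_eq_comp,
          ← M.star_rinner b a', inner_map_star, inner_self_eq_norm_sq_to_K]
        simp
      calc ‖π (M.rinner b a') ξ‖ ^ 2
          ≤ ‖M.toPreInd π ξ a'‖ * ‖M.toPreInd π ξ (M.lact (M.linner b b) a')‖ :=
            (Complex.le_norm_of_ofReal_eq h).trans (norm_inner_le_norm _ _)
        _ ≤ ‖M.toPreInd π ξ a'‖ * (‖M.linner b b‖ * ‖M.toPreInd π ξ a'‖) := by
            gcongr; exact M.norm_toPreInd_lact_le π ξ _ _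
        _ = ‖M.linner b b‖ * ‖a‖ ^ 2 := by
            rw [show M.toPreInd π ξ a' = a from (M.toPreInd π ξ).apply_symm_apply a]; ring

/-- The operator `a ⊗ ξ ↦ π(⟨b, a⟩_B) ξ` on the induced Hilbert space. -/
def indEval (b : X) : M.Ind π ξ →L[ℂ] H :=
  (M.preIndEval π ξ b).extend (UniformSpace.Completion.toComplL (𝕜 := ℂ))

@[simp]
theorem indEval_toInd (b a : X) : M.indEval π ξ b (M.toInd π ξ a) = π (M.rinner b a) ξ :=
  ContinuousLinearMap.extend_eq _ (UniformSpace.Completion.denseRange_coe)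
    (UniformSpace.Completion.isUniformInducing_coe _) _

theorem rinner_ract_left (a b : X) (d : B) :
    M.rinner (M.ract b (star d)) a = d * M.rinner b a := by
  rw [← M.star_rinner, M.rinner_ract, star_mul, star_star, M.star_rinner]

theorem map_indEval (d : B) (b : X) (v : M.Ind π ξ) :
    π d (M.indEval π ξ b v) = M.indEval π ξ (M.ract b (star d)) v := by
  induction v using ind_induction with
  | hp => apply isClosed_eq <;> fun_prop
  | h a => rw [indEval_toInd, indEval_toInd, rinner_ract_left, map_mul, mul_apply_eq_comp]

theorem inner_indEval_right (b : X) (v : M.Ind π ξ) :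
    inner ℂ ξ (M.indEval π ξ b v) = inner ℂ (M.toInd π ξ b) v := by
  induction v using ind_induction with
  | hp => apply isClosed_eq <;> fun_prop
  | h a => rw [indEval_toInd, inner_toInd]

theorem inner_indEval_indEval (b c : X) (v w : M.Ind π ξ) :
    inner ℂ (M.indEval π ξ b v) (M.indEval π ξ c w) =
      inner ℂ v (M.ind π ξ (M.linner b c) w) := by
  induction v using ind_induction with
  | hp => apply isClosed_eq <;> fun_prop
  | h a' =>
    induction w using ind_induction with
    | hp => apply isClosed_eq <;> fun_prop
    | h a =>
      rw [indEval_toInd, indEval_toInd, ind_toInd, inner_toInd, ← M.rinner_mul_rinner, map_mul,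
        mul_apply_eq_comp, ← M.star_rinner b a', inner_map_star]

theorem eq_zero_of_indEval_eq_zero {v : M.Ind π ξ} (h : ∀ b, M.indEval π ξ b v = 0) : v = 0 := by
  have : ∀ w : M.Ind π ξ, inner ℂ w v = 0 := fun w => by
    induction w using ind_induction with
    | hp => apply isClosed_eq <;> fun_prop
    | h b => rw [← inner_indEval_right, h, inner_zero_right]
  exact inner_self_eq_zero.1 (this v)

/-- A representation induced from an irreducible one has no nontrivial closed invariant
subspaces. -/
theorem ind_irreducible
    (hirr : ∀ K : Submodule ℂ H, IsClosed (K : Set H) → (∀ b, ∀ v ∈ K, π b v ∈ K) →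
      K = ⊥ ∨ K = ⊤) (N : Submodule ℂ (M.Ind π ξ)) (hN : IsClosed (N : Set (M.Ind π ξ)))
    (hinv : ∀ c, ∀ v ∈ N, M.ind π ξ c v ∈ N) : N = ⊥ ∨ N = ⊤ := by
  set S : Set H := {w | ∃ b, ∃ v ∈ N, w = M.indEval π ξ b v}
  set L := (Submodule.span ℂ S).topologicalClosure
  have hSL : S ⊆ L := Submodule.subset_span.trans (Submodule.le_topologicalClosure _)
  have hL : ∀ d, ∀ w ∈ L, π d w ∈ L := by
    intro d w hw
    refine map_mem_of_mem_closure_span (π d).toLinearMap (π d).continuous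
      (Submodule.isClosed_topologicalClosure _) ?_ hw
    rintro _ ⟨b, v, hv, rfl⟩
    exact hSL ⟨_, v, hv, M.map_indEval π ξ d b v⟩
  rcases hirr L (Submodule.isClosed_topologicalClosure _) hL with h | h
  · left
    refine (Submodule.eq_bot_iff _).2 fun v hv => M.eq_zero_of_indEval_eq_zero π ξ fun b => ?_
    exact (Submodule.mem_bot ℂ).1 (h ▸ hSL ⟨b, v, hv, rfl⟩)
  · right
    have : CompleteSpace N := hN.completeSpace_coe
    refine Submodule.orthogonal_eq_bot_iff.1 ((Submodule.eq_bot_iff _).2 fun v hv =>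
      M.eq_zero_of_indEval_eq_zero π ξ fun b => ?_)
    have h1 : Submodule.span ℂ S ≤ (ℂ ∙ M.indEval π ξ b v)ᗮ := by
      refine Submodule.span_le.2 ?_
      rintro _ ⟨c, w, hw, rfl⟩
      refine Submodule.mem_orthogonal_singleton_iff_inner_right.2 ?_
      rw [inner_indEval_indEval]
      exact Submodule.inner_left_of_mem_orthogonal (hinv _ w hw) hv
    have h2 : L ≤ (ℂ ∙ M.indEval π ξ b v)ᗮ :=
      Submodule.topologicalClosure_minimal _ h1 (Submodule.isClosed_orthogonal _)
    rw [h] at h2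
    exact inner_self_eq_zero.1
      (Submodule.mem_orthogonal_singleton_iff_inner_right.1 (h2 Submodule.mem_top))

/-- The induced ideal of a subset `J` of `B`: the closed span of the elements `⟨a d, b⟩_A` with
`d ∈ J`. -/
def indIdeal (J : Set B) : Submodule ℂ A :=
  (Submodule.span ℂ {c | ∃ a b d, d ∈ J ∧ c = M.linner (M.ract a d) b}).topologicalClosure

theorem mul_mul_mem_of_dense {S : Set A} (hS : Dense (Submodule.span ℂ S : Set A))
    {J : Submodule ℂ A} (hJ : IsClosed (J : Set A)) {c : A}
    (h : ∀ d ∈ S, ∀ e ∈ S, d * c * e ∈ J) (d e : A) : d * c * e ∈ J := by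
  refine map_mem_of_mem_closure_span (LinearMap.mulLeft ℂ (d * c))
    (by exact continuous_const_mul (d * c)) hJ (fun e he => ?_) (hS e)
  exact map_mem_of_mem_closure_span (LinearMap.mulRight ℂ e ∘ₗ LinearMap.mulRight ℂ c)
    (by exact (continuous_mul_const e).comp (continuous_mul_const c)) hJ
    (fun d hd => h d hd e he) (hS d)

theorem mem_indIdeal_of_forall_rinner_mem {J : Set B} {c : A}
    (h : ∀ a b, M.rinner b (M.lact c a) ∈ J) : c ∈ M.indIdeal J := by
  have hcl := Submodule.isClosed_topologicalClosure
    (Submodule.span ℂ {c | ∃ a b d, d ∈ J ∧ c = M.linner (M.ract a d) b})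
  refine mem_of_forall_mul_mul_mem hcl (mul_mul_mem_of_dense M.dense_linner hcl ?_)
  rintro _ ⟨a, b, rfl⟩ _ ⟨a', b', rfl⟩
  rw [M.linner_mul_mul_linner]
  exact Submodule.le_topologicalClosure _ (Submodule.subset_span ⟨a, b', _, h a' b, rfl⟩)

theorem map_rinner_lact_eq_zero
    (hirr : ∀ K : Submodule ℂ H, IsClosed (K : Set H) → (∀ b, ∀ v ∈ K, π b v ∈ K) →
      K = ⊥ ∨ K = ⊤) (hξ : ξ ≠ 0) {c : A} (hc : M.ind π ξ c = 0) (a b : X) :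
    π (M.rinner b (M.lact c a)) = 0 := by
  have hz : ∀ a, π (M.rinner b (M.lact c a)) ξ = 0 := fun a => by
    rw [← indEval_toInd, ← ind_toInd, hc, zero_apply, map_zero]
  refine π.eq_zero_of_forall_mul_apply_eq_zero hirr hξ (fun d => ?_) (hz a)
  rw [← mul_apply_eq_comp, ← map_mul, ← M.rinner_ract, ← M.lact_ract, hz]

/-- The kernel of the representation induced from an irreducible representation `π` is the ideal
induced from the kernel of `π`. -/
theorem ind_eq_zero_iff
    (hirr : ∀ K : Submodule ℂ H, IsClosed (K : Set H) → (∀ b, ∀ v ∈ K, π b v ∈ K) →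
      K = ⊥ ∨ K = ⊤) (hξ : ξ ≠ 0) (c : A) :
    M.ind π ξ c = 0 ↔ c ∈ M.indIdeal {d | π d = 0} := by
  refine ⟨fun hc => M.mem_indIdeal_of_forall_rinner_mem fun a b =>
    M.map_rinner_lact_eq_zero π ξ hirr hξ hc a b, fun hc => ?_⟩
  refine (Submodule.mem_bot ℂ).1 (map_mem_of_mem_closure_span
    (M.ind π ξ : A →ₗ[ℂ] (M.Ind π ξ →L[ℂ] M.Ind π ξ))
    (M.ind π ξ).continuous_of_cstar (J := ⊥) (by exact isClosed_singleton) ?_ hc)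
  rintro _ ⟨a, b, d, hd, rfl⟩
  refine (Submodule.mem_bot ℂ).2 (M.ind_ext π ξ fun a' => inner_self_eq_zero (𝕜 := ℂ).1 ?_)
  have hd : π d = 0 := hd
  change inner ℂ (M.ind π ξ _ _) (M.ind π ξ _ _) = 0
  rw [ind_toInd, inner_toInd, M.lact_linner, M.ract_ract, M.rinner_ract, map_mul, map_mul, hd]
  simp

/-- A representation induced from a nonzero irreducible one is nonzero. -/
theorem exists_ind_ne_zero
    (hirr : ∀ K : Submodule ℂ H, IsClosed (K : Set H) → (∀ b, ∀ v ∈ K, π b v ∈ K) →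
      K = ⊥ ∨ K = ⊤) (hξ : ξ ≠ 0) (hπ : ∃ d, π d ≠ 0) : ∃ c, M.ind π ξ c ≠ 0 := by
  by_contra! h
  obtain ⟨d, hd⟩ := hπ
  have hker : IsClosed ((LinearMap.ker (π : B →ₗ[ℂ] (H →L[ℂ] H)) : Submodule ℂ B) : Set B) :=
    isClosed_eq π.continuous_of_cstar continuous_const
  have h2 : ∀ d e : B, π (d * e) = 0 := fun d e => by
    refine map_mem_of_mem_closure_span (LinearMap.mulLeft ℂ d) (by exact continuous_const_mul d)
      hker ?_ (M.dense_rinner e)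
    rintro _ ⟨b', a, rfl⟩
    refine map_mem_of_mem_closure_span (LinearMap.mulRight ℂ (M.rinner b' a))
      (by exact continuous_mul_const (M.rinner b' a)) hker ?_ (M.dense_rinner d)
    rintro _ ⟨b, a', rfl⟩
    change π (M.rinner b a' * M.rinner b' a) = 0
    rw [rinner_mul_rinner]
    exact M.map_rinner_lact_eq_zero π ξ hirr hξ (h _) a b
  have h3 := h2 (star d) d
  rw [map_mul, map_star] at h3
  exact hd ((CStarRing.star_mul_self_eq_zero_iff _).1 h3)

end ImprimitivityData

namespace FellBundleData

/-- The fibre `B(x)`, as a type. -/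
@[ext]
structure Fib (Ω : FellBundleData) (x : Ω.G) where
  /-- the underlying element of the total space -/
  val : Ω.T
  p_val : Ω.p val = x

namespace Fib

variable {Ω : FellBundleData} {x y z : Ω.G}

attribute [simp] p_val

instance : CanLift Ω.T (Ω.Fib x) val (fun t => Ω.p t = x) := ⟨fun t h => ⟨⟨t, h⟩, rfl⟩⟩

instance : Zero (Ω.Fib x) := ⟨⟨Ω.bzero x, Ω.p_bzero x⟩⟩
instance : Add (Ω.Fib x) := ⟨fun a b => ⟨Ω.badd a.val b.val, by simp [Ω.p_badd]⟩⟩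
instance : SMul ℂ (Ω.Fib x) := ⟨fun c a => ⟨Ω.bsmul c a.val, by simp [Ω.p_bsmul]⟩⟩
instance : Neg (Ω.Fib x) := ⟨fun a => (-1 : ℂ) • a⟩
instance : Norm (Ω.Fib x) := ⟨fun a => Ω.bnorm a.val⟩

theorem val_zero : (0 : Ω.Fib x).val = Ω.bzero x := rfl
theorem val_add (a b : Ω.Fib x) : (a + b).val = Ω.badd a.val b.val := rfl
theorem val_smul (c : ℂ) (a : Ω.Fib x) : (c • a).val = Ω.bsmul c a.val := rfl
theorem val_neg (a : Ω.Fib x) : (-a).val = Ω.bsmul (-1) a.val := rfl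
theorem norm_def (a : Ω.Fib x) : ‖a‖ = Ω.bnorm a.val := rfl

instance : AddCommGroup (Ω.Fib x) :=
  have zero_add' (a : Ω.Fib x) : 0 + a = a := by
    have h := Ω.bzero_badd a.val
    rw [a.p_val] at h
    exact Fib.ext h
  have add_comm' (a b : Ω.Fib x) : a + b = b + a := Fib.ext (Ω.badd_comm _ _ (by simp))
  { add_assoc := fun a b c => Fib.ext (Ω.badd_assoc _ _ _ (by simp) (by simp))
    zero_add := zero_add'
    add_zero := fun a => (add_comm' a 0).trans (zero_add' a)
    add_comm := add_comm'
    neg_add_cancel := fun a => by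
      have h := Ω.badd_neg a.val
      rw [a.p_val] at h
      exact (add_comm' (-a) a).trans (Fib.ext h)
    nsmul := nsmulRec
    zsmul := zsmulRec }

instance : Module ℂ (Ω.Fib x) where
  one_smul a := Fib.ext (Ω.one_bsmul _)
  mul_smul c d a := Fib.ext (Ω.mul_bsmul _ _ _)
  smul_zero c := Fib.ext (Ω.bsmul_bzero _ _)
  smul_add c a b := Fib.ext (Ω.bsmul_badd _ _ _ (by simp))
  add_smul c d a := Fib.ext (Ω.add_bsmul _ _ _)
  zero_smul a := Fib.ext ((Ω.zero_bsmul _).trans (by rw [a.p_val, val_zero]))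

theorem normedSpaceCore : NormedSpace.Core ℂ (Ω.Fib x) where
  norm_nonneg a := Ω.bnorm_nonneg _
  norm_smul c a := Ω.bnorm_bsmul _ _
  norm_triangle a b := Ω.bnorm_badd_le _ _ (by simp)
  norm_eq_zero_iff a := by
    rw [norm_def, Ω.bnorm_eq_zero, a.p_val, Fib.ext_iff, val_zero]

instance : NormedAddCommGroup (Ω.Fib x) := NormedAddCommGroup.ofCore normedSpaceCore
instance : NormedSpace ℂ (Ω.Fib x) := NormedSpace.ofCore normedSpaceCore

theorem dist_def (a b : Ω.Fib x) : dist a b = Ω.bnorm (Ω.badd a.val (Ω.bsmul (-1) b.val)) := by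
  rw [dist_eq_norm, sub_eq_add_neg, norm_def, val_add, val_neg]

instance : CompleteSpace (Ω.Fib x) := by
  refine Metric.complete_of_cauchySeq_tendsto fun f hf => ?_
  obtain ⟨L, hL, h⟩ := Ω.fiber_complete x (fun n => (f n).val) (fun n => (f n).p_val) (by
    intro ε hε
    obtain ⟨N, hN⟩ := Metric.cauchySeq_iff.1 hf ε hε
    exact ⟨N, fun m n hm hn => by rw [← dist_def]; exact hN m hm n hn⟩)
  refine ⟨⟨L, hL⟩, tendsto_iff_dist_tendsto_zero.2 ?_⟩
  simpa only [dist_def] using h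

theorem isInducing_val : Topology.IsInducing (val : Ω.Fib x → Ω.T) := by
  refine Topology.isInducing_iff_nhds.2 fun a => le_antisymm ?_ ?_
  · rintro V ⟨U, hU, hUV⟩
    obtain ⟨ε, hε, h⟩ := Ω.norm_nbhd_fiber a.val U hU
    refine Metric.mem_nhds_iff.2 ⟨ε, hε, fun b hb => hUV (h _ (by simp) ?_)⟩
    rw [← dist_def]
    exact hb
  · intro V hV
    obtain ⟨ε, hε, h⟩ := Metric.mem_nhds_iff.1 hV
    obtain ⟨U, hU, hUε⟩ := Ω.fiber_nbhd_norm a.val ε hε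
    refine ⟨U, hU, fun b hb => h ?_⟩
    rw [Metric.mem_ball, dist_def]
    exact hUε _ hb (by simp)

theorem val_injective : Function.Injective (val : Ω.Fib x → Ω.T) := fun _ _ h => Fib.ext h

theorem range_val : Set.range (val : Ω.Fib x → Ω.T) = Ω.fiberSet x :=
  Set.ext fun b => ⟨by rintro ⟨a, rfl⟩; exact a.p_val, fun h => ⟨⟨b, h⟩, rfl⟩⟩

theorem isClosedEmbedding_val : Topology.IsClosedEmbedding (val : Ω.Fib x → Ω.T) where
  toIsInducing := isInducing_val
  injective := val_injective
  isClosed_range := by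
    have := Ω.t2G
    rw [range_val]
    exact isClosed_singleton.preimage Ω.p_cont

theorem val_list_sum (l : List (Ω.Fib x)) :
    l.sum.val = (l.map val).foldr Ω.badd (Ω.bzero x) := by
  induction l with
  | nil => rfl
  | cons a l ih => rw [List.sum_cons, val_add, ih, List.map_cons, List.foldr_cons]

theorem spanIn_eq {S : Set Ω.T} (hS : S ⊆ Ω.fiberSet x) :
    Ω.spanIn x S = val '' (Submodule.span ℂ (val ⁻¹' S : Set (Ω.Fib x)) : Set (Ω.Fib x)) := by
  ext t
  constructor
  · rintro ⟨l, hl, rfl⟩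
    have hp : ∀ a ∈ l, Ω.p a = x := by
      intro a ha
      obtain ⟨c, s, hs, rfl⟩ := hl a ha
      rw [Ω.p_bsmul]
      exact hS hs
    obtain ⟨l, rfl⟩ : ∃ l' : List (Ω.Fib x), l'.map val = l :=
      ⟨l.pmap (fun a h => ⟨a, h⟩) hp, by simp [List.map_pmap]⟩
    refine ⟨l.sum, ?_, val_list_sum l⟩
    refine list_sum_mem fun a ha => ?_
    obtain ⟨c, s, hs, h⟩ := hl a.val (List.mem_map_of_mem ha)
    have : a = c • (⟨s, hS hs⟩ : Ω.Fib x) := Fib.ext h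
    rw [this]
    exact Submodule.smul_mem _ _ (Submodule.subset_span hs)
  · rintro ⟨a, ha, rfl⟩
    suffices ∃ l : List (Ω.Fib x),
        (∀ b ∈ l, ∃ (c : ℂ) (s : Ω.Fib x), s.val ∈ S ∧ b = c • s) ∧ a = l.sum by
      obtain ⟨l, hl, rfl⟩ := this
      refine ⟨l.map val, fun b hb => ?_, val_list_sum l⟩
      obtain ⟨b, hb', rfl⟩ := List.mem_map.1 hb
      obtain ⟨c, s, hs, rfl⟩ := hl b hb'
      exact ⟨c, s.val, hs, rfl⟩
    induction ha using Submodule.span_induction with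
    | mem a ha => exact ⟨[a], by simpa using ⟨1, a, ha, (one_smul ℂ a).symm⟩, by simp⟩
    | zero => exact ⟨[], by simp, rfl⟩
    | add a b _ _ iha ihb =>
      obtain ⟨l, hl, rfl⟩ := iha
      obtain ⟨m, hm, rfl⟩ := ihb
      refine ⟨l ++ m, fun b hb => ?_, List.sum_append.symm⟩
      exact (List.mem_append.1 hb).elim (hl b) (hm b)
    | smul c a _ iha =>
      obtain ⟨l, hl, rfl⟩ := iha
      refine ⟨l.map (c • ·), fun b hb => ?_, List.smul_sum⟩
      obtain ⟨b, hb', rfl⟩ := List.mem_map.1 hb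
      obtain ⟨e, s, hs, rfl⟩ := hl b hb'
      exact ⟨c * e, s, hs, smul_smul c e s⟩

theorem closedSpan_eq {S : Set Ω.T} (hS : S ⊆ Ω.fiberSet x) :
    Ω.closedSpan x S = val '' closure
      (Submodule.span ℂ (val ⁻¹' S : Set (Ω.Fib x)) : Set (Ω.Fib x)) := by
  rw [closedSpan, spanIn_eq hS, isClosedEmbedding_val.closure_image_eq]

/-- The closed linear span of `S ⊆ B(x)`, as a subspace of the fibre. -/
def closedSubmodule (x : Ω.G) (S : Set Ω.T) : Submodule ℂ (Ω.Fib x) :=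
  (Submodule.span ℂ (val ⁻¹' S)).topologicalClosure

theorem isClosed_closedSubmodule (S : Set Ω.T) :
    IsClosed (closedSubmodule x S : Set (Ω.Fib x)) :=
  Submodule.isClosed_topologicalClosure _

theorem mem_closedSubmodule_of_val_mem {S : Set Ω.T} {a : Ω.Fib x} (ha : a.val ∈ S) :
    a ∈ closedSubmodule x S :=
  subset_closure (Submodule.subset_span ha)

theorem val_mem_closedSpan_iff {S : Set Ω.T} (hS : S ⊆ Ω.fiberSet x) {a : Ω.Fib x} :
    a.val ∈ Ω.closedSpan x S ↔ a ∈ closedSubmodule x S := by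
  rw [closedSpan_eq hS, val_injective.mem_set_image]
  rfl

theorem closedSpan_subset_fiberSet {S : Set Ω.T} (hS : S ⊆ Ω.fiberSet x) :
    Ω.closedSpan x S ⊆ Ω.fiberSet x := by
  rw [closedSpan_eq hS]
  rintro _ ⟨a, _, rfl⟩
  exact a.p_val

theorem closedSpan_subset_closedSpan {S S' : Set Ω.T} (hS : S ⊆ Ω.fiberSet x)
    (hS' : S' ⊆ Ω.fiberSet x) (h : ∀ a : Ω.Fib x, a.val ∈ S → a ∈ closedSubmodule x S') :
    Ω.closedSpan x S ⊆ Ω.closedSpan x S' := by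
  intro t ht
  have ht' : Ω.p t = x := closedSpan_subset_fiberSet hS ht
  lift t to Ω.Fib x using ht'
  rw [val_mem_closedSpan_iff hS] at ht
  rw [val_mem_closedSpan_iff hS']
  exact map_mem_of_mem_closure_span LinearMap.id continuous_id (isClosed_closedSubmodule S') h ht

/-- The multiplication `B(x) × B(y) → B(x y)`, as a bilinear map. -/
def mul (h : Ω.src x = Ω.rng y) (hz : Ω.gmul x y = z) : Ω.Fib x →ₗ[ℂ] Ω.Fib y →ₗ[ℂ] Ω.Fib z :=
  have hp {a : Ω.Fib x} {b : Ω.Fib y} : Ω.src (Ω.p a.val) = Ω.rng (Ω.p b.val) := by simp [h]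
  LinearMap.mk₂ ℂ (fun a b => ⟨Ω.bmul a.val b.val, by rw [Ω.p_bmul _ _ hp]; simp [hz]⟩)
    (fun _ _ _ => Fib.ext (Ω.bmul_badd _ _ _ (by simp) hp))
    (fun _ _ _ => Fib.ext (Ω.bsmul_bmul _ _ _ hp))
    (fun _ _ _ => Fib.ext (Ω.badd_bmul _ _ _ (by simp) hp))
    (fun _ _ _ => Fib.ext (Ω.bmul_bsmul _ _ _ hp))

theorem val_mul (h : Ω.src x = Ω.rng y) (hz : Ω.gmul x y = z) (a : Ω.Fib x) (b : Ω.Fib y) :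
    (mul h hz a b).val = Ω.bmul a.val b.val := rfl

theorem continuous_mul (h : Ω.src x = Ω.rng y) (hz : Ω.gmul x y = z) :
    Continuous fun q : Ω.Fib x × Ω.Fib y => mul h hz q.1 q.2 := by
  refine isInducing_val.continuous_iff.2 ?_
  have : Continuous fun q : Ω.Fib x × Ω.Fib y =>
      (⟨(q.1.val, q.2.val), by simp [h]⟩ : {q : Ω.T × Ω.T // Ω.src (Ω.p q.1) = Ω.rng (Ω.p q.2)}) :=
    ((isInducing_val.continuous.comp continuous_fst).prodMk
      (isInducing_val.continuous.comp continuous_snd)).subtype_mk _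
  exact Ω.cont_bmul.comp this

theorem mul_assoc {w xy yw : Ω.G} (h₁ : Ω.src x = Ω.rng y) (h₂ : Ω.src y = Ω.rng w)
    (h₃ : Ω.src xy = Ω.rng w) (h₄ : Ω.src x = Ω.rng yw) (hxy : Ω.gmul x y = xy)
    (hyw : Ω.gmul y w = yw) (hz : Ω.gmul xy w = z) (hz' : Ω.gmul x yw = z)
    (a : Ω.Fib x) (b : Ω.Fib y) (c : Ω.Fib w) :
    mul h₃ hz (mul h₁ hxy a b) c = mul h₄ hz' a (mul h₂ hyw b c) :=
  Fib.ext (Ω.bmul_assoc _ _ _ (by simp [h₁]) (by simp [h₂]))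

/-- The involution `B(x) → B(x⁻¹)`, as a conjugate-linear map. -/
def conj (hz : Ω.ginv x = z) : Ω.Fib x →ₗ⋆[ℂ] Ω.Fib z where
  toFun a := ⟨Ω.bstar a.val, by rw [Ω.p_bstar]; simp [hz]⟩
  map_add' a b := Fib.ext (Ω.bstar_badd _ _ (by simp))
  map_smul' c a := Fib.ext (Ω.bstar_bsmul _ _)

theorem val_conj (hz : Ω.ginv x = z) (a : Ω.Fib x) : (conj hz a).val = Ω.bstar a.val := rfl

theorem conj_conj (hz : Ω.ginv x = z) (hx : Ω.ginv z = x) (a : Ω.Fib x) :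
    conj hx (conj hz a) = a := Fib.ext (Ω.bstar_bstar _)

theorem conj_mul {x' y' z' : Ω.G} (h : Ω.src x = Ω.rng y) (hz : Ω.gmul x y = z)
    (hx : Ω.ginv x = x') (hy : Ω.ginv y = y') (hz' : Ω.ginv z = z') (h' : Ω.src y' = Ω.rng x')
    (hm : Ω.gmul y' x' = z') (a : Ω.Fib x) (b : Ω.Fib y) :
    conj hz' (mul h hz a b) = mul h' hm (conj hy b) (conj hx a) :=
  Fib.ext (Ω.bstar_bmul _ _ (by simp [h]))

end Fib

end FellBundleData

theorem LCGroupoid.src_unit (Γ : LCGroupoid) {u : Γ.G} (hu : Γ.rng u = u) : Γ.src u = u := by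
  rw [← hu, Γ.src_rng]

theorem LCGroupoid.gmul_unit (Γ : LCGroupoid) {u : Γ.G} (hu : Γ.rng u = u) : Γ.gmul u u = u := by
  have h := Γ.gmul_rng u
  rwa [hu] at h

namespace FellBundleData

instance (Ω : FellBundleData) (x : Ω.G) : Fact (Ω.rng (Ω.rng x) = Ω.rng x) := ⟨Ω.rng_rng x⟩
instance (Ω : FellBundleData) (x : Ω.G) : Fact (Ω.rng (Ω.src x) = Ω.src x) := ⟨Ω.rng_src x⟩

namespace Fib

section Unit

variable {Ω : FellBundleData} {u : Ω.G} [hu : Fact (Ω.rng u = u)]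

/-- The fibre over a unit is a C*-algebra. -/
instance : NonUnitalCStarAlgebra (Ω.Fib u) :=
  have hs : Ω.src u = Ω.rng u := by rw [Ω.src_unit hu.out, hu.out]
  have hm : Ω.gmul u u = u := Ω.gmul_unit hu.out
  have hi : Ω.ginv u = u := Ω.ginv_unit u hu.out
  { (inferInstance : NormedAddCommGroup (Ω.Fib u)),
    (inferInstance : NormedSpace ℂ (Ω.Fib u)),
    (inferInstance : CompleteSpace (Ω.Fib u)) with
    mul := fun a b => mul hs hm a b
    left_distrib := fun a b c => map_add (mul hs hm a) b c
    right_distrib := fun a b c => LinearMap.map_add₂ (mul hs hm) a b c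
    zero_mul := fun a => LinearMap.map_zero₂ (mul hs hm) a
    mul_zero := fun a => map_zero (mul hs hm a)
    mul_assoc := fun a b c => mul_assoc hs hs hs hs hm hm hm hm a b c
    norm_mul_le := fun a b => Ω.unit_submul _ _ (by simp) (by simp [hu.out])
    star := conj hi
    star_involutive := conj_conj hi hi
    star_mul := conj_mul hs hm hi hi hi hs hm
    star_add := map_add (conj hi)
    norm_mul_self_le := fun a => by
      rw [← sq]
      exact (Ω.cstar_identity a.val).ge
    star_smul := fun c a => (conj hi).map_smulₛₗ c a
    smul_assoc := fun c a b => LinearMap.map_smul₂ (mul hs hm) c a b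
    smul_comm := fun c a b => (map_smul (mul hs hm a) c b).symm }

theorem val_unit_mul (a b : Ω.Fib u) : (a * b).val = Ω.bmul a.val b.val := rfl

theorem val_star (a : Ω.Fib u) : (star a).val = Ω.bstar a.val := rfl

end Unit

theorem exists_norm_mul_mul_le {Ω : FellBundleData} {x y z w v : Ω.G} (h : Ω.src x = Ω.rng y)
    (hz : Ω.gmul x y = z) (h' : Ω.src w = Ω.rng z) (hv : Ω.gmul w z = v) (b : Ω.Fib w)
    (a : Ω.Fib y) : ∃ C, ∀ c, ‖mul h' hv b (mul h hz c a)‖ ≤ C * ‖c‖ :=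
  have hc : Continuous ((mul h' hv b).comp ((mul h hz).flip a)) :=
    (continuous_mul h' hv).comp <| (Continuous.prodMk_right b).comp <|
      (continuous_mul h hz).comp (Continuous.prodMk_left a)
  ⟨_, ContinuousLinearMap.le_opNorm ⟨_, hc⟩⟩

end Fib

end FellBundleData

namespace FellBundle

open FellBundleData

variable (Ω : FellBundle)

theorem dense_span_mul {x y z : Ω.G} (h : Ω.src x = Ω.rng y) (hz : Ω.gmul x y = z) :
    Dense (Submodule.span ℂ {c | ∃ a b, c = Fib.mul h hz a b} :
      Set (Ω.toFellBundleData.Fib z)) := by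
  intro c
  subst hz
  have hS : {t | ∃ a b, Ω.p a = x ∧ Ω.p b = y ∧ t = Ω.bmul a b} ⊆
      Ω.toFellBundleData.fiberSet (Ω.gmul x y) := by
    rintro _ ⟨a, b, rfl, rfl, rfl⟩
    exact Ω.p_bmul _ _ h
  have hc := (Fib.val_mem_closedSpan_iff hS).1 (by rw [Ω.saturated x y h]; exact c.p_val)
  refine closure_mono (Submodule.span_mono ?_) hc
  rintro c ⟨a, b, ha, hb, hab⟩
  exact ⟨⟨a, ha⟩, ⟨b, hb⟩, Fib.ext hab⟩

/-- The fibre `B(x)` as an imprimitivity bimodule over `B(r(x))` and `B(s(x))`. -/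
def imprimitivityData (x : Ω.G) :
    ImprimitivityData (Ω.toFellBundleData.Fib (Ω.rng x)) (Ω.toFellBundleData.Fib (Ω.src x))
      (Ω.toFellBundleData.Fib x) where
  lact := Fib.mul (Ω.src_rng x) (Ω.gmul_rng x)
  ract a d := Fib.mul (Ω.rng_src x).symm (Ω.gmul_src x) a d
  linner a b := Fib.mul (Ω.rng_ginv x).symm (Ω.gmul_ginv x) a (Fib.conj rfl b)
  rinner := (Fib.mul (Ω.src_ginv x) (Ω.ginv_gmul x)).comp (Fib.conj rfl)
  lact_mul c d a := Fib.mul_assoc _ _ _ _ _ _ _ _ c d a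
  lact_linner a b c := Fib.mul_assoc _ (Ω.src_ginv x) _ _ _ (Ω.ginv_gmul x) _ _ a _ c
  ract_ract a d e := Fib.mul_assoc _ _ _ _ _ _ _ _ a d e
  linner_mul_mul_linner a b c a' b' := by
    refine (Fib.mul_assoc (Ω.src_rng x) _ _ _ (Ω.gmul_rng x) _ _ _ _ a' _).symm.trans (congrArg
      (Fib.mul (Ω.rng_ginv x).symm (Ω.gmul_ginv x) · (Fib.conj rfl b')) ?_)
    exact (Fib.mul_assoc _ _ _ (Ω.src_rng x) _ _ _ (Ω.gmul_rng x) _ c a').trans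
      (Fib.mul_assoc _ (Ω.src_ginv x) _ _ _ (Ω.ginv_gmul x) _ _ a _ _)
  lact_ract c a d := (Fib.mul_assoc _ _ _ _ _ _ _ _ c a d).symm
  rinner_lact a b c := by
    refine Fib.ext ?_
    simp only [Fib.val_mul, Fib.val_conj, LinearMap.comp_apply, Fib.val_star]
    rw [Ω.bstar_bmul _ _ (by simp [Ω.src_rng]), Ω.bmul_assoc] <;>
      simp [Ω.p_bstar, Ω.src_ginv, Ω.rng_ginv, Ω.src_rng, Ω.rng_rng]
  rinner_ract a b d := (Fib.mul_assoc (Ω.src_ginv x) _ _ (Ω.src_ginv x) (Ω.ginv_gmul x) _ _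
    (Ω.ginv_gmul x) _ b d).symm
  star_rinner a b := by
    refine Fib.ext ?_
    simp only [Fib.val_mul, Fib.val_conj, LinearMap.comp_apply, Fib.val_star]
    rw [Ω.bstar_bmul _ _ (by simp [Ω.p_bstar, Ω.src_ginv]), Ω.bstar_bstar]
  rinner_self a := by
    obtain ⟨c, hc, h⟩ := Ω.bmul_pos a.val
    exact ⟨⟨c, by rw [hc, a.p_val]⟩, Fib.ext h⟩
  rinner_bound a := by
    exact Fib.exists_norm_mul_mul_le (Ω.src_rng x) (Ω.gmul_rng x) (Ω.src_ginv x) (Ω.ginv_gmul x)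
      (Fib.conj rfl a) a
  dense_linner := by
    refine (Ω.dense_span_mul (Ω.rng_ginv x).symm (Ω.gmul_ginv x)).mono (Submodule.span_mono ?_)
    rintro _ ⟨a, b, rfl⟩
    exact ⟨a, Fib.conj (Ω.ginv_ginv x) b, by rw [Fib.conj_conj]⟩
  dense_rinner := by
    refine (Ω.dense_span_mul (Ω.src_ginv x) (Ω.ginv_gmul x)).mono (Submodule.span_mono ?_)
    rintro _ ⟨a, b, rfl⟩
    refine ⟨Fib.conj (Ω.ginv_ginv x) a, b, ?_⟩
    rw [LinearMap.comp_apply, Fib.conj_conj]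

end FellBundle

namespace FellBundleData

variable {Ω : FellBundleData}

/-- The generators `(a d) b*` of the induced ideal `h_x(J)`. -/
def hGen (x : Ω.G) (J : Set Ω.T) : Set Ω.T :=
  {t | ∃ a b d, Ω.p a = x ∧ Ω.p b = x ∧ d ∈ J ∧ t = Ω.bmul (Ω.bmul a d) (Ω.bstar b)}

theorem hGen_subset_fiberSet {x : Ω.G} {J : Set Ω.T} (hJ : J ⊆ Ω.fiberSet (Ω.src x)) :
    hGen x J ⊆ Ω.fiberSet (Ω.rng x) := by
  rintro _ ⟨a, b, d, ha, hb, hd, rfl⟩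
  have hd : Ω.p d = Ω.src x := hJ hd
  have had : Ω.p (Ω.bmul a d) = x := by
    rw [Ω.p_bmul _ _ (by rw [ha, hd, Ω.rng_src]), ha, hd, Ω.gmul_src]
  change Ω.p _ = _
  rw [Ω.p_bmul _ _ (by rw [had, Ω.p_bstar, hb, Ω.rng_ginv]), had, Ω.p_bstar, hb, Ω.gmul_ginv]

theorem hIdeal_subset_fiberSet {x : Ω.G} {J : Set Ω.T} (hJ : J ⊆ Ω.fiberSet (Ω.src x)) :
    Ω.hIdeal x J ⊆ Ω.fiberSet (Ω.rng x) :=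
  Fib.closedSpan_subset_fiberSet (hGen_subset_fiberSet hJ)

theorem bmul_bmul_bmul_bmul {a a' d s t : Ω.T} (h₁ : Ω.src (Ω.p a) = Ω.rng (Ω.p a'))
    (h₂ : Ω.src (Ω.p a') = Ω.rng (Ω.p d)) (h₃ : Ω.src (Ω.p d) = Ω.rng (Ω.p s))
    (h₄ : Ω.src (Ω.p s) = Ω.rng (Ω.p t)) :
    Ω.bmul (Ω.bmul (Ω.bmul a a') d) (Ω.bmul s t) =
      Ω.bmul (Ω.bmul a (Ω.bmul (Ω.bmul a' d) s)) t := by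
  have h₅ : Ω.src (Ω.p (Ω.bmul a' d)) = Ω.rng (Ω.p s) := by
    rw [Ω.p_bmul _ _ h₂, Ω.src_gmul _ _ h₂, h₃]
  have h₆ : Ω.src (Ω.p a) = Ω.rng (Ω.p (Ω.bmul a' d)) := by
    rw [Ω.p_bmul _ _ h₂, Ω.rng_gmul _ _ h₂, h₁]
  have h₇ : Ω.src (Ω.p (Ω.bmul a (Ω.bmul a' d))) = Ω.rng (Ω.p s) := by
    rw [Ω.p_bmul _ _ h₆, Ω.src_gmul _ _ h₆, h₅]
  rw [Ω.bmul_assoc a a' d h₁ h₂, ← Ω.bmul_assoc a _ s h₆ h₅, Ω.bmul_assoc _ s t h₇ h₄]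

/-- A representation of the C*-algebra `B(u)`, as a homomorphism of `*`-algebras. -/
def IsFiberRep.toStarAlgHom {u : Ω.G} [Fact (Ω.rng u = u)] {H : Type} [NormedAddCommGroup H]
    [InnerProductSpace ℂ H] [CompleteSpace H] {π : Ω.T → H →L[ℂ] H} (h : Ω.IsFiberRep u π) :
    Ω.Fib u →⋆ₙₐ[ℂ] (H →L[ℂ] H) where
  toFun a := π a.val
  map_smul' c a := h.2.1 c _ a.p_val
  map_zero' := by
    have := h.2.1 0 _ (0 : Ω.Fib u).p_val
    rwa [← Fib.val_smul, zero_smul, zero_smul] at this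
  map_add' a b := h.1 _ _ a.p_val b.p_val
  map_mul' a b := h.2.2.1 _ _ a.p_val b.p_val
  map_star' a := h.2.2.2.1 _ a.p_val

theorem mem_primFiber_of_starAlgHom {u : Ω.G} [hu : Fact (Ω.rng u = u)] {H : Type}
    [NormedAddCommGroup H] [InnerProductSpace ℂ H] [CompleteSpace H]
    (ρ : Ω.Fib u →⋆ₙₐ[ℂ] (H →L[ℂ] H)) (hρ : ∃ a, ρ a ≠ 0)
    (hirr : ∀ K : Submodule ℂ H, IsClosed (K : Set H) →
      (∀ a, ∀ v ∈ K, ρ a v ∈ K) → K = ⊥ ∨ K = ⊤) :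
    Fib.val '' {a : Ω.Fib u | ρ a = 0} ∈ Ω.PrimFiber u := by
  classical
  let π : Ω.T → H →L[ℂ] H := fun t => if h : Ω.p t = u then ρ ⟨t, h⟩ else 0
  have hπ (a : Ω.Fib u) : π a.val = ρ a := dif_pos a.p_val
  refine ⟨hu.out, H, inferInstance, inferInstance, inferInstance, π,
    ⟨⟨fun a b ha hb => ?_, fun c a ha => ?_, fun a b ha hb => ?_, fun a ha => ?_,
      fun a ha => ?_⟩, ?_, fun K hK h => hirr K hK fun a v hv => ?_⟩, ?_⟩
  · lift a to Ω.Fib u using ha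
    lift b to Ω.Fib u using hb
    rw [← Fib.val_add, hπ, hπ, hπ, map_add]
  · lift a to Ω.Fib u using ha
    rw [← Fib.val_smul, hπ, hπ, map_smul]
  · lift a to Ω.Fib u using ha
    lift b to Ω.Fib u using hb
    rw [← Fib.val_unit_mul, hπ, hπ, hπ, map_mul]
    rfl
  · lift a to Ω.Fib u using ha
    rw [← Fib.val_star, hπ, hπ, map_star]
    rfl
  · lift a to Ω.Fib u using ha
    rw [hπ]
    exact NonUnitalStarAlgHom.norm_apply_le ρ a
  · obtain ⟨a, ha⟩ := hρ
    exact ⟨a.val, a.p_val, by rwa [hπ]⟩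
  · rw [← hπ]
    exact h a.val a.p_val v hv
  · ext t
    constructor
    · rintro ⟨a, ha, rfl⟩
      exact ⟨a.p_val, (hπ a).trans ha⟩
    · rintro ⟨ht, h⟩
      exact ⟨⟨t, ht⟩, (hπ ⟨t, ht⟩).symm.trans h, rfl⟩

theorem hIdeal_eq_of_mem_primFiber {u : Ω.G} {P : Set Ω.T} (hP : P ∈ Ω.PrimFiber u) :
    Ω.hIdeal u P = P := by
  obtain ⟨hu, H, _, _, _, π, ⟨hπ, -⟩, rfl⟩ := hP
  have : Fact (Ω.rng u = u) := ⟨hu⟩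
  set P := {a | Ω.p a = u ∧ π a = 0} with hPdef
  have hgen : hGen u P ⊆ Ω.fiberSet u := by
    have h := hGen_subset_fiberSet (x := u) (J := P) (fun a ha => by
      rw [Ω.src_unit hu]; exact ha.1)
    rwa [hu] at h
  have hid : Ω.hIdeal u P = Ω.closedSpan u (hGen u P) := by
    rw [hIdeal, hu]
    rfl
  have hmem (a : Ω.Fib u) : a.val ∈ Ω.hIdeal u P ↔ a ∈ Fib.closedSubmodule u (hGen u P) := by
    rw [hid, Fib.val_mem_closedSpan_iff hgen]
  have hmemP (a : Ω.Fib u) : a.val ∈ P ↔ hπ.toStarAlgHom a = 0 := and_iff_right a.p_val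
  refine Set.Subset.antisymm (fun t ht => ?_) fun t ht => ?_
  · have htu : Ω.p t = u := Fib.closedSpan_subset_fiberSet hgen (hid ▸ ht)
    lift t to Ω.Fib u using htu
    rw [hmemP]
    rw [hmem] at ht
    refine map_mem_of_mem_closure_span (J := ⊥) (hπ.toStarAlgHom : Ω.Fib u →ₗ[ℂ] H →L[ℂ] H)
      (hπ.toStarAlgHom.continuous_of_cstar) isClosed_singleton ?_ ht
    rintro c ⟨a, b, d, ha, hb, hd, hc⟩
    lift a to Ω.Fib u using ha
    lift b to Ω.Fib u using hb
    lift d to Ω.Fib u using hd.1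
    have : c = a * d * star b := Fib.ext hc
    change hπ.toStarAlgHom c = 0
    rw [this, map_mul, map_mul, (hmemP d).1 hd, mul_zero, zero_mul]
  · lift t to Ω.Fib u using ht.1
    rw [hmem]
    refine mem_of_forall_mul_mul_mem (Fib.isClosed_closedSubmodule _) fun d e => ?_
    refine Fib.mem_closedSubmodule_of_val_mem
      ⟨d.val, (star e).val, t.val, d.p_val, (star e).p_val, ht, ?_⟩
    rw [← Fib.val_star, star_star]
    rfl

end FellBundleData

namespace FellBundle

open FellBundleData

variable (Ω : FellBundle)

theorem hIdeal_mem_primFiber (x : Ω.G) {P : Set Ω.T}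
    (hP : P ∈ Ω.toFellBundleData.PrimFiber (Ω.src x)) :
    Ω.toFellBundleData.hIdeal x P ∈ Ω.toFellBundleData.PrimFiber (Ω.rng x) := by
  obtain ⟨-, H, _, _, _, π, ⟨hπ, ⟨a, ha, hne⟩, hirr⟩, rfl⟩ := hP
  let M := Ω.imprimitivityData x
  let ρ : Ω.toFellBundleData.Fib (Ω.src x) →⋆ₙₐ[ℂ] (H →L[ℂ] H) := hπ.toStarAlgHom
  have hρ (K : Submodule ℂ H) (hK : IsClosed (K : Set H)) (h : ∀ b, ∀ v ∈ K, ρ b v ∈ K) :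
      K = ⊥ ∨ K = ⊤ := hirr K hK fun b hb => h ⟨b, hb⟩
  obtain ⟨ξ, hξ⟩ : ∃ ξ : H, ξ ≠ 0 := by
    by_contra! h
    exact hne (ContinuousLinearMap.ext fun v => h _)
  have key := mem_primFiber_of_starAlgHom (M.ind ρ ξ)
    (M.exists_ind_ne_zero ρ ξ hρ hξ ⟨⟨a, ha⟩, hne⟩) (M.ind_irreducible ρ ξ hρ)
  convert key using 1
  have hgen : hGen x {a | Ω.p a = Ω.src x ∧ π a = 0} ⊆ Ω.toFellBundleData.fiberSet (Ω.rng x) :=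
    hGen_subset_fiberSet fun b hb => hb.1
  change Ω.toFellBundleData.closedSpan (Ω.rng x) (hGen x _) = _
  rw [Fib.closedSpan_eq hgen]
  congr 1
  ext c
  rw [Set.mem_ofPred_eq, M.ind_eq_zero_iff ρ ξ hρ hξ]
  suffices h : (Fib.val ⁻¹' hGen x {a | Ω.p a = Ω.src x ∧ π a = 0} :
      Set (Ω.toFellBundleData.Fib (Ω.rng x))) =
      {c | ∃ a b d, d ∈ {d | ρ d = 0} ∧ c = M.linner (M.ract a d) b} by
    rw [h]
    rfl
  ext c
  constructor
  · rintro ⟨a, b, d, ha, hb, hd, hc⟩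
    exact ⟨⟨a, ha⟩, ⟨b, hb⟩, ⟨d, hd.1⟩, hd.2, Fib.ext hc⟩
  · rintro ⟨a, b, d, hd, rfl⟩
    exact ⟨a.val, b.val, d.val, a.p_val, b.p_val, ⟨d.p_val, hd⟩, rfl⟩

theorem hIdeal_hIdeal {x y : Ω.G} (h : Ω.src x = Ω.rng y) {J : Set Ω.T}
    (hJ : J ⊆ Ω.toFellBundleData.fiberSet (Ω.src y)) :
    Ω.toFellBundleData.hIdeal x (Ω.toFellBundleData.hIdeal y J) =
      Ω.toFellBundleData.hIdeal (Ω.gmul x y) J := by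
  have hy : hGen y J ⊆ Ω.toFellBundleData.fiberSet (Ω.rng y) := hGen_subset_fiberSet hJ
  have hyJ := hIdeal_subset_fiberSet hJ
  have hx : hGen x (Ω.toFellBundleData.hIdeal y J) ⊆ Ω.toFellBundleData.fiberSet (Ω.rng x) :=
    hGen_subset_fiberSet (by rwa [h])
  have hxy : hGen (Ω.gmul x y) J ⊆ Ω.toFellBundleData.fiberSet (Ω.rng x) := by
    rw [← Ω.rng_gmul x y h]
    exact hGen_subset_fiberSet (by rwa [Ω.src_gmul x y h])
  have hi := Ω.ginv_gmul_eq x y h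
  have hxy_eq : Ω.toFellBundleData.hIdeal (Ω.gmul x y) J =
      Ω.toFellBundleData.closedSpan (Ω.rng x) (hGen (Ω.gmul x y) J) := by
    rw [hIdeal, Ω.rng_gmul x y h]
    rfl
  rw [hxy_eq]
  refine Set.Subset.antisymm (Fib.closedSpan_subset_closedSpan hx hxy ?_)
    (Fib.closedSpan_subset_closedSpan hxy hx ?_)
  · rintro c ⟨a, b, d, ha, hb, hd, hc⟩
    lift a to Ω.toFellBundleData.Fib x using ha
    lift b to Ω.toFellBundleData.Fib x using hb
    lift d to Ω.toFellBundleData.Fib (Ω.rng y) using hyJ hd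
    have h₁ : Ω.src x = Ω.rng (Ω.rng y) := by rw [Ω.rng_rng, h]
    have h₂ : Ω.gmul x (Ω.rng y) = x := by rw [← h, Ω.gmul_src]
    let f := ((Fib.mul (Ω.rng_ginv x).symm (Ω.gmul_ginv x)).flip (Fib.conj rfl b)).comp
      (Fib.mul h₁ h₂ a)
    have hf : Continuous f := (Fib.continuous_mul (Ω.rng_ginv x).symm (Ω.gmul_ginv x)).comp <|
      ((Fib.continuous_mul h₁ h₂).comp (Continuous.prodMk_right a)).prodMk continuous_const
    have hcf : c = f d := Fib.ext hc
    rw [hcf]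
    refine map_mem_of_mem_closure_span f hf (Fib.isClosed_closedSubmodule _) ?_
      ((Fib.val_mem_closedSpan_iff hy).1 hd)
    rintro e ⟨a', b', d', ha', hb', hd', he⟩
    have hp : Ω.p d' = Ω.src y := hJ hd'
    refine Fib.mem_closedSubmodule_of_val_mem
      ⟨Ω.bmul a.val a', Ω.bmul b.val b', d', ?_, ?_, hd', ?_⟩
    · rw [Ω.p_bmul] <;> simp [ha', h]
    · rw [Ω.p_bmul] <;> simp [hb', h]
    · change Ω.bmul (Ω.bmul a.val e.val) (Ω.bstar b.val) = _
      rw [he, Ω.bstar_bmul _ _ (by simp [hb', h]), bmul_bmul_bmul_bmul] <;>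
        simp [ha', hb', hp, h, Ω.p_bstar, Ω.rng_src, Ω.src_src, Ω.src_ginv, Ω.rng_ginv]
  · rintro c ⟨g, k, d, hg, hk, hd, hc⟩
    lift g to Ω.toFellBundleData.Fib (Ω.gmul x y) using hg
    lift k to Ω.toFellBundleData.Fib (Ω.gmul x y) using hk
    lift d to Ω.toFellBundleData.Fib (Ω.src y) using hJ hd
    have h₁ : Ω.src (Ω.gmul x y) = Ω.rng (Ω.src y) := by rw [Ω.src_gmul x y h, Ω.rng_src]
    have h₂ : Ω.gmul (Ω.gmul x y) (Ω.src y) = Ω.gmul x y := by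
      rw [← Ω.src_gmul x y h, Ω.gmul_src]
    have h₃ : Ω.src (Ω.gmul x y) = Ω.rng (Ω.ginv (Ω.gmul x y)) := by rw [Ω.rng_ginv]
    have h₄ : Ω.gmul (Ω.gmul x y) (Ω.ginv (Ω.gmul x y)) = Ω.rng x := by
      rw [Ω.gmul_ginv, Ω.rng_gmul x y h]
    have h₅ : Ω.src (Ω.ginv y) = Ω.rng (Ω.ginv x) := by rw [Ω.src_ginv, Ω.rng_ginv, h]
    have hc' : c = Fib.mul h₃ h₄ (Fib.mul h₁ h₂ g d) (Fib.conj rfl k) := Fib.ext hc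
    rw [hc']
    generalize Fib.conj rfl k = k'
    refine map_mem_of_mem_closure_span
      (((Fib.mul h₃ h₄).flip k').comp ((Fib.mul h₁ h₂).flip d))
      ((Fib.continuous_mul h₃ h₄).comp <|
        ((Fib.continuous_mul h₁ h₂).comp (Continuous.prodMk_left d)).prodMk continuous_const)
      (Fib.isClosed_closedSubmodule _) ?_ (Ω.dense_span_mul h rfl g)
    rintro _ ⟨a, a', rfl⟩
    refine map_mem_of_mem_closure_span (Fib.mul h₃ h₄ (Fib.mul h₁ h₂ (Fib.mul h rfl a a') d))
      ((Fib.continuous_mul h₃ h₄).comp (Continuous.prodMk_right _))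
      (Fib.isClosed_closedSubmodule _) ?_ (Ω.dense_span_mul h₅ hi.symm k')
    rintro _ ⟨s, t, rfl⟩
    refine Fib.mem_closedSubmodule_of_val_mem ⟨a.val, Ω.bstar t.val,
      Ω.bmul (Ω.bmul a'.val d.val) s.val, a.p_val, by rw [Ω.p_bstar, t.p_val, Ω.ginv_ginv], ?_, ?_⟩
    · have hs : Ω.bmul (Ω.bmul a'.val d.val) s.val ∈ hGen y J :=
        ⟨a'.val, Ω.bstar s.val, d.val, a'.p_val, by rw [Ω.p_bstar, s.p_val, Ω.ginv_ginv], hd,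
          by rw [Ω.bstar_bstar]⟩
      have hs' : Ω.p (Ω.bmul (Ω.bmul a'.val d.val) s.val) = Ω.rng y := hy hs
      exact (Fib.val_mem_closedSpan_iff hy (a := ⟨_, hs'⟩)).2
        (Fib.mem_closedSubmodule_of_val_mem hs)
    · rw [Ω.bstar_bstar]
      exact bmul_bmul_bmul_bmul (by simp [h]) (by simp [Ω.rng_src])
        (by simp [Ω.src_src, Ω.rng_ginv]) (by simp [h₅])

end FellBundle

/-- For a Fell bundle `p : B → G` over a locally compact
Hausdorff groupoid with `A := Γ₀(G⁰; B)`, the Rieffel correspondences satisfy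
`h_x ∘ h_y = h_{x y}` on `Prim A(s(y))` for every composable pair `(x, y) ∈ G⁽²⁾`,
and `h_u` is the identity on `Prim A(u)` for every unit `u ∈ G⁰`; moreover `h_x`
maps `Prim A(s(x))` into `Prim A(r(x))`.  Consequently the formula
`x · (s(x), P) := (r(x), h_x(P))` defines an action of `G` on
`Prim A = {(u, P) : u ∈ G⁰, P ∈ Prim A(u)}`. -/
theorem rieffel_action (Ω : FellBundle) :
    (∀ (x : Ω.G) (P : Set Ω.T), P ∈ Ω.toFellBundleData.PrimFiber (Ω.src x) →
      Ω.toFellBundleData.hIdeal x P ∈ Ω.toFellBundleData.PrimFiber (Ω.rng x)) ∧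
    (∀ x y : Ω.G, Ω.src x = Ω.rng y →
      ∀ P ∈ Ω.toFellBundleData.PrimFiber (Ω.src y),
        Ω.toFellBundleData.hIdeal x (Ω.toFellBundleData.hIdeal y P) =
          Ω.toFellBundleData.hIdeal (Ω.gmul x y) P) ∧
    (∀ u : Ω.G, Ω.rng u = u →
      ∀ P ∈ Ω.toFellBundleData.PrimFiber u, Ω.toFellBundleData.hIdeal u P = P) := by
  exact ⟨fun x _ hP => Ω.hIdeal_mem_primFiber x hP,
    fun _ _ h _ ⟨_, _, _, _, _, _, _, hP⟩ => Ω.hIdeal_hIdeal h (hP ▸ fun _ ha => ha.1),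
    fun _ _ _ hP => FellBundleData.hIdeal_eq_of_mem_primFiber hP⟩
end
end
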